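/- arXiv:1604.02967 — 4 statements merged into one kernel-verified Lean document; each statement's English description precedes it below -/
import Mathlib

section
/- Let p be an odd prime and t a positive integer. The quadratic Gauss sum G = ∑_{x ∈ F_{p^t}^*} η(x) ω_p^{Tr(x)} equals (-1)^{t-1} p^{t/2} if p ≡ 1 (mod 4), and (-1)^{t-1} (√-1)^t p^{t/2} if p ≡ 3 (mod 4). -/
open scoped Classical

noncomputable def ePow (p : ℕ) (a : ZMod p) : ℂ :=
  Complex.exp (2 * Real.pi * Complex.I * (a.val : ℂ) / (p : ℂ))

noncomputable def quadChar (F : Type*) [Field F] [Fintype F] (x : F) : ℤ :=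
  if x = 0 then 0 else if IsSquare x then 1 else -1

lemma qgs_sum_sq (F : Type*) [Field F] [Fintype F] [DecidableEq F] (hF : ringChar F ≠ 2)
    (ψ : AddChar F ℂ) (hψ : ψ ≠ 1) :
    ∑ x : F, ψ (x ^ 2) = ∑ x : F, (quadraticChar F x : ℂ) * ψ x := by
  have h0 : ∑ x : F, ψ x = 0 := AddChar.sum_eq_zero_of_ne_one hψ
  have h1 : ∑ x : F, ψ (x ^ 2) = ∑ a : F, ∑ x : F with x ^ 2 = a, ψ (x ^ 2) :=
    (Finset.sum_fiberwise _ _ _).symm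
  have h2 : ∀ a : F, ∑ x : F with x ^ 2 = a, ψ (x ^ 2) = ((quadraticChar F a : ℂ) + 1) * ψ a := by
    intro a
    have h3 := quadraticChar_card_sqrts hF a
    have h4 : {x : F | x ^ 2 = a}.toFinset = Finset.univ.filter (fun x : F => x ^ 2 = a) := by
      ext x; simp
    rw [h4] at h3
    rw [Finset.sum_congr rfl (g := fun _ => ψ a) (by intro x hx; rw [(Finset.mem_filter.1 hx).2]),
      Finset.sum_const, nsmul_eq_mul]
    congr 1
    exact_mod_cast h3
  rw [h1, Finset.sum_congr rfl (fun a _ => h2 a)]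
  simp only [add_mul, one_mul, Finset.sum_add_distrib, h0, add_zero]


lemma qgs_addChar_sum {A ι : Type*} [AddCommMonoid A] (ψ : AddChar A ℂ) (s : Finset ι) (f : ι → A) :
    ψ (∑ i ∈ s, f i) = ∏ i ∈ s, ψ (f i) := by
  induction s using Finset.induction_on with
  | empty => simp
  | insert i s hi ih => rw [Finset.sum_insert hi, Finset.prod_insert hi, AddChar.map_add_eq_mul, ih]

lemma qgs_finRotate {n : ℕ} (i : Fin n) (p : ℕ) {F : Type*} [Monoid F] (x : F)
    (hx : x ^ p ^ n = x) : x ^ p ^ ((i : ℕ) + 1) = x ^ p ^ ((finRotate n i : Fin n) : ℕ) := by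
  cases n with
  | zero => exact i.elim0
  | succ k =>
    by_cases h : i = Fin.last k
    · subst h
      rw [finRotate_last]
      simpa using hx
    · rw [coe_finRotate_of_ne_last h]

lemma qgs_det (p : ℕ) [Fact p.Prime] (F : Type*) [Field F] [Fintype F] [Algebra (ZMod p) F]
    (n : ℕ) (hn : Module.finrank (ZMod p) F = n)
    (b : Fin n → F) :
    ∃ δ : F, δ ^ 2 = algebraMap (ZMod p) F (Algebra.discr (ZMod p) b) ∧
      δ ^ p = (-1) ^ (n - 1) * δ := by
  have : CharP F p := charP_of_injective_algebraMap (algebraMap (ZMod p) F).injective p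
  have hcard : Fintype.card F = p ^ n := by
    rw [Module.card_eq_pow_finrank (K := ZMod p) (V := F), ZMod.card, hn]
  let M : Matrix (Fin n) (Fin n) F := Matrix.of fun i j => b j ^ (p ^ (i : ℕ))
  refine ⟨M.det, ?_, ?_⟩
  · rw [Algebra.discr_def, RingHom.map_det, sq]
    nth_rewrite 1 [← Matrix.det_transpose M]
    rw [← Matrix.det_mul]
    congr 1
    ext i j
    simp only [Matrix.mul_apply, Matrix.transpose_apply, M, Matrix.of_apply,
      RingHom.mapMatrix_apply, Matrix.map_apply, Algebra.traceMatrix_apply, Algebra.traceForm_apply]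
    rw [FiniteField.algebraMap_trace_eq_sum_pow, hn, Finset.sum_range]
    simp [mul_pow]
  · have h1 : M.det ^ p = ((frobenius F p).mapMatrix M).det := by
      rw [← RingHom.map_det, frobenius_def]
    have h2 : (frobenius F p).mapMatrix M = M.submatrix (finRotate n) id := by
      ext i j
      rw [RingHom.mapMatrix_apply, Matrix.map_apply, frobenius_def, Matrix.submatrix_apply]
      simp only [M, Matrix.of_apply, id]
      rw [← pow_mul, ← pow_succ]
      apply qgs_finRotate
      rw [← hcard, FiniteField.pow_card]
    rw [h1, h2, Matrix.det_permute, sign_finRotate]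
    push_cast
    rfl

lemma qgs_discr_char (p : ℕ) [Fact p.Prime] (hp2 : p ≠ 2) (F : Type*) [Field F] [Fintype F]
    [Algebra (ZMod p) F]
    (n : ℕ) (hn : Module.finrank (ZMod p) F = n)
    (b : Module.Basis (Fin n) (ZMod p) F) :
    quadraticChar (ZMod p) (Algebra.discr (ZMod p) b) = (-1) ^ (n - 1) := by
  obtain ⟨δ, h1, h2⟩ := qgs_det p F n hn b
  have h0 : Algebra.discr (ZMod p) b ≠ 0 := Algebra.discr_not_zero_of_basis _ b
  have hδ : δ ≠ 0 := by
    rintro rfl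
    apply h0
    apply (algebraMap (ZMod p) F).injective
    rw [← h1]; simp
  have hp1 : 1 ≤ p := (Fact.out : p.Prime).one_lt.le
  have h3 : δ ^ (p - 1) = (-1) ^ (n - 1) := by
    apply mul_right_cancel₀ hδ
    rw [← h2, ← pow_succ, Nat.sub_add_cancel hp1]
  have hodd : p % 2 = 1 := (Fact.out : p.Prime).eq_two_or_odd.resolve_left hp2
  have hc : ringChar (ZMod p) ≠ 2 := by rwa [ZMod.ringChar_zmod_n]
  have h4 := quadraticChar_eq_pow_of_char_ne_two' hc (Algebra.discr (ZMod p) b)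
  rw [ZMod.card] at h4
  have h5 : ((quadraticChar (ZMod p) (Algebra.discr (ZMod p) b) : ℤ) : ZMod p)
      = (-1) ^ (n - 1) := by
    rw [h4]
    apply (algebraMap (ZMod p) F).injective
    rw [map_pow, ← h1, ← pow_mul, show 2 * (p / 2) = p - 1 by omega, h3]
    simp
  have hne : ((1 : ℤ) : ZMod p) ≠ ((-1 : ℤ) : ZMod p) := by
    intro h
    push_cast at h
    exact Ring.neg_one_ne_one_of_char_ne_two hc h.symm
  rcases quadraticChar_dichotomy h0 with h | h <;> rcases neg_one_pow_eq_or ℤ (n - 1) with h' | h'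
  · rw [h, h']
  · exfalso; apply hne
    have h6 := h5
    rw [h] at h6
    rw [h6, ← h']; push_cast; rfl
  · exfalso; apply hne
    have h6 := h5
    rw [h] at h6
    rw [h6]
    exact_mod_cast congrArg (Int.cast : ℤ → ZMod p) h'.symm
  · rw [h, h']

lemma qgs_lift (p t : ℕ) [Fact p.Prime] (hp2 : p ≠ 2) (F : Type*) [Field F] [Fintype F]
    [Algebra (ZMod p) F] (ht : Module.finrank (ZMod p) F = t) (ψ : AddChar (ZMod p) ℂ)
    (hψ : ψ ≠ 1) :
    ∑ x : F, ψ (Algebra.trace (ZMod p) F (x ^ 2)) =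
      (-1) ^ (t - 1) * (∑ x : ZMod p, ψ (x ^ 2)) ^ t := by
  have hc : ringChar (ZMod p) ≠ 2 := by rwa [ZMod.ringChar_zmod_n]
  have h2 : (2 : ZMod p) ≠ 0 := Ring.two_ne_zero hc
  let _ : Invertible (2 : ZMod p) := invertibleOfNonzero h2
  have hsymm : LinearMap.IsSymm (Algebra.traceForm (ZMod p) F) :=
    ⟨fun x y => (Algebra.traceForm_isSymm (ZMod p)).eq x y⟩
  obtain ⟨b, hb⟩ : ∃ b : Module.Basis (Fin t) (ZMod p) F,
      LinearMap.IsOrthoᵢ (Algebra.traceForm (ZMod p) F) b := by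
    rw [← ht]
    exact LinearMap.BilinForm.exists_orthogonal_basis hsymm
  have horth : ∀ i j, i ≠ j → Algebra.trace (ZMod p) F (b i * b j) = 0 := by
    intro i j hij
    exact hb hij
  set a : Fin t → ZMod p := fun i => Algebra.trace (ZMod p) F (b i * b i) with ha
  have hdisc : Algebra.discr (ZMod p) b = ∏ i, a i := by
    rw [Algebra.discr_def, ← Matrix.det_diagonal]
    congr 1
    ext i j
    rw [Algebra.traceMatrix_apply, Algebra.traceForm_apply]
    by_cases hij : i = j
    · subst hij; simp [a]
    · rw [Matrix.diagonal_apply_ne _ hij, horth i j hij]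
  have ha0 : ∀ i, a i ≠ 0 := by
    have h0 : Algebra.discr (ZMod p) b ≠ 0 := Algebra.discr_not_zero_of_basis _ b
    rw [hdisc] at h0
    intro i
    exact Finset.prod_ne_zero_iff.1 h0 i (Finset.mem_univ _)
  have hchar := qgs_discr_char p hp2 F t ht b
  have htr : ∀ y : Fin t → ZMod p,
      Algebra.trace (ZMod p) F ((∑ i, y i • b i) ^ 2) = ∑ i, a i * y i ^ 2 := by
    intro y
    rw [sq, Finset.sum_mul_sum, map_sum]
    apply Finset.sum_congr rfl
    intro i _
    rw [map_sum, Finset.sum_eq_single i]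
    · rw [smul_mul_smul_comm, map_smul, smul_eq_mul]
      simp only [a]; ring
    · intro j _ hj
      rw [smul_mul_smul_comm, map_smul, horth i j hj.symm, smul_zero]
    · intro h; exact absurd (Finset.mem_univ i) h
  have h1d : ∀ c : ZMod p, c ≠ 0 → ∑ y : ZMod p, ψ (c * y ^ 2) =
      (quadraticChar (ZMod p) c : ℂ) * ∑ y : ZMod p, ψ (y ^ 2) := by
    intro c hc0
    have hprim : (ψ.mulShift c) ≠ 1 := by
      intro h
      apply hψ
      ext y
      have := congrArg (fun f : AddChar (ZMod p) ℂ => f (c⁻¹ * y)) h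
      simpa [AddChar.mulShift_apply, hc0] using this
    have e1 := qgs_sum_sq (ZMod p) hc (ψ.mulShift c) hprim
    simp only [AddChar.mulShift_apply] at e1
    rw [e1, qgs_sum_sq (ZMod p) hc ψ hψ, Finset.mul_sum]
    apply Fintype.sum_bijective (fun x => c * x) (mulLeft_bijective₀ c hc0)
    intro x
    have e2 : (quadraticChar (ZMod p) c : ℂ) * (quadraticChar (ZMod p) c : ℂ) = 1 := by
      rw [← sq]
      exact_mod_cast quadraticChar_sq_one hc0
    have e3 : quadraticChar (ZMod p) (c * x) = quadraticChar (ZMod p) c * quadraticChar (ZMod p) x :=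
      map_mul _ _ _
    rw [e3, Int.cast_mul]
    linear_combination -((quadraticChar (ZMod p) x : ℂ) * ψ (c * x)) * e2
  have hsum : ∑ x : F, ψ (Algebra.trace (ZMod p) F (x ^ 2)) =
      ∑ y : Fin t → ZMod p, ∏ i, ψ (a i * y i ^ 2) := by
    symm
    apply Fintype.sum_equiv b.equivFun.symm.toEquiv
    intro y
    have : b.equivFun.symm.toEquiv y = ∑ i, y i • b i := b.equivFun_symm_apply y
    rw [this, htr, qgs_addChar_sum]
  rw [hsum, ← Fintype.prod_sum (fun i y => ψ (a i * y ^ 2)),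
    Finset.prod_congr rfl (fun i _ => h1d (a i) (ha0 i)), Finset.prod_mul_distrib,
    Finset.prod_const, Finset.card_univ, Fintype.card_fin, ← Int.cast_prod, ← map_prod, ← hdisc,
    hchar]
  push_cast
  rfl

lemma qgs_pow_mul_prod {R : Type*} [CommMonoid R] (x : R) (m : ℕ) (f : ℕ → R) :
    x ^ m * ∏ k ∈ Finset.range m, f k = ∏ k ∈ Finset.range m, x * f k := by
  rw [Finset.prod_mul_distrib, Finset.prod_const, Finset.card_range]

open Polynomial in
lemma qgs_iter_pow {R : Type*} [CommRing R] (n k : ℕ) (hk : k ≤ n) :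
    ∃ V : R[X], (fun f : R[X] => X * derivative f)^[k] ((X - 1) ^ n) = (X - 1) ^ (n - k) * V ∧
      V.eval 1 = (n.descFactorial k : R) := by
  induction k with
  | zero => exact ⟨1, by simp, by simp⟩
  | succ k ih =>
    obtain ⟨V, h1, h2⟩ := ih (by omega)
    obtain ⟨d, hd⟩ : ∃ d, n - k = d + 1 := ⟨n - k - 1, by omega⟩
    refine ⟨X * (((d + 1 : ℕ) : R[X]) * V + (X - 1) * derivative V), ?_, ?_⟩
    · rw [Function.iterate_succ_apply', h1, hd, show n - (k + 1) = d by omega]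
      simp only [derivative_mul, derivative_pow, derivative_sub, derivative_X, derivative_one,
        Nat.add_sub_cancel]
      push_cast
      ring_nf
      simp [map_add]
      try ring
    · rw [Nat.descFactorial_succ, hd]
      simp [h2]

open Polynomial in
lemma qgs_iter_geom {R : Type*} [CommRing R] (n k : ℕ) :
    (fun f : R[X] => X * derivative f)^[k] (∑ j ∈ Finset.range n, X ^ j) =
      ∑ j ∈ Finset.range n, C ((j : R) ^ k) * X ^ j := by
  induction k with
  | zero => simp
  | succ k ih =>
    rw [Function.iterate_succ_apply', ih]
    simp only [derivative_sum, Finset.mul_sum, derivative_C_mul, derivative_X_pow]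
    apply Finset.sum_congr rfl
    intro j _
    cases j with
    | zero => simp
    | succ j =>
      simp only [Nat.add_sub_cancel, map_pow, pow_succ]
      simp
      try ring

open Polynomial in
lemma qgs_prod {R : Type*} [CommRing R] (p m : ℕ) :
    ∃ U : R[X], ∏ k ∈ Finset.range m, ((X : R[X]) ^ (k + 1) - X ^ (p - (k + 1))) =
      (X - 1) ^ m * U ∧
      U.eval 1 = ∏ k ∈ Finset.range m, (((k + 1 : ℕ) : R) - ((p - (k + 1) : ℕ) : R)) := by
  refine ⟨∏ k ∈ Finset.range m, ((∑ i ∈ Finset.range (k + 1), X ^ i) -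
    ∑ i ∈ Finset.range (p - (k + 1)), X ^ i), ?_, ?_⟩
  · rw [qgs_pow_mul_prod]
    apply Finset.prod_congr rfl
    intro k _
    rw [mul_sub, mul_geom_sum, mul_geom_sum]
    ring
  · rw [eval_prod]
    apply Finset.prod_congr rfl
    intro k _
    simp [eval_finsetSum]

open Polynomial in
lemma qgs_eps (p m : ℕ) [Fact p.Prime] (hm : p = 2 * m + 1) (hm0 : 0 < m) (ε : ℤ) (ζ : ℂ)
    (hζ : IsPrimitiveRoot ζ p)
    (h : ∑ j ∈ Finset.range p, ((quadraticChar (ZMod p) (j : ZMod p) : ℤ) : ℂ) * ζ ^ j =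
      ε * ∏ k ∈ Finset.range m, (ζ ^ (k + 1) - ζ ^ (p - (k + 1)))) :
    (ε : ZMod p) * 2 ^ m * (m.factorial : ZMod p) ^ 2 = -1 := by
  have hp : p.Prime := Fact.out
  have hc : ringChar (ZMod p) ≠ 2 := by rw [ZMod.ringChar_zmod_n]; omega
  set f : ℤ[X] := ∑ j ∈ Finset.range p, C (quadraticChar (ZMod p) (j : ZMod p) : ℤ) * X ^ j -
    C ε * ∏ k ∈ Finset.range m, (X ^ (k + 1) - X ^ (p - (k + 1))) with hf
  have hf0 : aeval ζ f = 0 := by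
    simp only [hf, map_sub, map_sum, map_mul, map_prod, map_pow, aeval_X, aeval_C]
    rw [sub_eq_zero]
    simpa using h
  have hdvd : cyclotomic p ℤ ∣ f := by
    rw [cyclotomic_eq_minpoly hζ hp.pos]
    exact minpoly.isIntegrallyClosed_dvd (hζ.isIntegral hp.pos) hf0
  have hcyc : cyclotomic p (ZMod p) = (X - 1) ^ (p - 1) := by
    have := cyclotomic_mul_prime_eq_pow_of_not_dvd (ZMod p) (p := p) (n := 1)
      (by intro h; exact hp.one_lt.ne' (Nat.dvd_one.1 h))
    simpa using this
  have hdvd2 : (X - 1 : (ZMod p)[X]) ^ (2 * m) ∣ f.map (Int.castRingHom (ZMod p)) := by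
    have := Polynomial.map_dvd (Int.castRingHom (ZMod p)) hdvd
    rwa [map_cyclotomic, hcyc, show p - 1 = 2 * m by omega] at this
  obtain ⟨U, hU, hU1⟩ := qgs_prod (R := ZMod p) p m
  obtain ⟨V, hV, hV1⟩ := qgs_iter_pow (R := ZMod p) (2 * m) m (by omega)
  have hmap : f.map (Int.castRingHom (ZMod p)) = (X - 1) ^ m * (V - C (ε : ZMod p) * U) := by
    have e1 : (X - 1 : (ZMod p)[X]) ^ (2 * m) = ∑ j ∈ Finset.range p, X ^ j := by
      rw [← cyclotomic_prime, hcyc, show p - 1 = 2 * m by omega]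
    rw [e1, qgs_iter_geom, show 2 * m - m = m by omega] at hV
    rw [mul_sub, ← hV, mul_left_comm, ← hU, hf]
    simp only [Polynomial.map_sub, Polynomial.map_mul, Polynomial.map_sum, Polynomial.map_prod,
      Polynomial.map_pow, map_X, map_C]
    simp only [eq_intCast (Int.castRingHom (ZMod p))]
    congr 1
    apply Finset.sum_congr rfl
    intro j _
    rw [quadraticChar_eq_pow_of_char_ne_two' hc, ZMod.card, show p / 2 = m by omega]
  rw [hmap, show 2 * m = m + m by omega, pow_add] at hdvd2
  have hX : (X - 1 : (ZMod p)[X]) ≠ 0 := by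
    simpa using X_sub_C_ne_zero (1 : ZMod p)
  have h3 := (dvd_trans (dvd_pow_self (X - 1 : (ZMod p)[X]) hm0.ne')
    ((mul_dvd_mul_iff_left (pow_ne_zero m hX)).1 hdvd2))
  have h4 : V.eval 1 - (ε : ZMod p) * U.eval 1 = 0 := by
    obtain ⟨w, hw⟩ := h3
    have := congrArg (eval 1) hw
    simpa using this
  have hU2 : U.eval 1 = 2 ^ m * (m.factorial : ZMod p) := by
    rw [hU1, ← Finset.prod_range_add_one_eq_factorial, Nat.cast_prod]
    rw [qgs_pow_mul_prod]
    apply Finset.prod_congr rfl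
    intro k hk
    have := Finset.mem_range.1 hk
    rw [Nat.cast_sub (by omega)]
    simp
    ring
  have hW : ((2 * m).descFactorial m : ZMod p) * (m.factorial : ZMod p) = -1 := by
    have e := Nat.factorial_mul_descFactorial (show m ≤ 2 * m by omega)
    rw [show 2 * m - m = m by omega] at e
    rw [mul_comm, ← Nat.cast_mul, e, show 2 * m = p - 1 by omega]
    exact ZMod.wilsons_lemma p
  rw [hV1, hU2, sub_eq_zero] at h4
  rw [← hW, h4]
  ring

lemma qgs_fact_sq (p m : ℕ) [Fact p.Prime] (hm : p = 2 * m + 1) :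
    (m.factorial : ZMod p) ^ 2 = -(-1) ^ m := by
  have hW : ((2 * m).descFactorial m : ZMod p) * (m.factorial : ZMod p) = -1 := by
    have e := Nat.factorial_mul_descFactorial (show m ≤ 2 * m by omega)
    rw [show 2 * m - m = m by omega] at e
    rw [mul_comm, ← Nat.cast_mul, e, show 2 * m = p - 1 by omega]
    exact ZMod.wilsons_lemma p
  have h1 : ((2 * m).descFactorial m : ZMod p) = (-1) ^ m * (m.factorial : ZMod p) := by
    rw [Nat.descFactorial_eq_prod_range, ← Finset.prod_range_add_one_eq_factorial, Nat.cast_prod,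
      Nat.cast_prod]
    rw [qgs_pow_mul_prod]
    apply Finset.prod_congr rfl
    intro k hk
    have := Finset.mem_range.1 hk
    have hz : ((2 * m + 1 : ℕ) : ZMod p) = 0 := by rw [← hm]; simp
    rw [Nat.cast_sub (by omega)]
    push_cast at hz ⊢
    linear_combination hz
  rw [h1] at hW
  have h2 : ((-1 : ZMod p) ^ m) * (-1) ^ m = 1 := by rw [← mul_pow]; simp
  linear_combination (-1) ^ m * hW - (m.factorial : ZMod p) ^ 2 * h2

lemma qgs_Q_sq (p m : ℕ) (hm : p = 2 * m + 1) (hp : p.Prime) (hm0 : 0 < m) (ζ : ℂ)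
    (hζ : IsPrimitiveRoot ζ p) :
    (∏ k ∈ Finset.range m, (ζ ^ (k + 1) - ζ ^ (p - (k + 1)))) ^ 2 = (-1) ^ m * p := by
  have hξ : IsPrimitiveRoot (ζ ^ 2) (2 * m + 1) := by
    rw [← hm]
    exact hζ.pow_of_coprime 2 ((Nat.coprime_primes Nat.prime_two hp).2 (by omega))
  have h1 := hξ.prod_one_sub_pow_eq_order
  rw [two_mul, Finset.prod_range_add, ← Finset.prod_range_reflect (fun k => 1 - (ζ ^ 2) ^ (m + k + 1)),
    ← Finset.prod_mul_distrib] at h1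
  have h2 : (p : ℂ) = (((m + m : ℕ) : ℂ)) + 1 := by rw [hm]; push_cast; ring
  rw [h2, ← h1]
  rw [qgs_pow_mul_prod, ← Finset.prod_pow]
  apply Finset.prod_congr rfl
  intro k hk
  have := Finset.mem_range.1 hk
  have hxy : ζ ^ (k + 1) * ζ ^ (p - (k + 1)) = 1 := by
    rw [← pow_add, show k + 1 + (p - (k + 1)) = p by omega, hζ.pow_eq_one]
  rw [show m + (m - 1 - k) + 1 = p - (k + 1) by omega, ← pow_mul, ← pow_mul, mul_comm 2, mul_comm 2,
    pow_mul, pow_mul]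
  linear_combination (ζ ^ (k + 1) * ζ ^ (p - (k + 1)) - 1) * hxy

lemma qgs_Q_val (p m : ℕ) (hm : p = 2 * m + 1) (hp : p.Prime) (hm0 : 0 < m) :
    ∏ k ∈ Finset.range m, (Complex.exp (2 * Real.pi * Complex.I / p) ^ (k + 1) -
      Complex.exp (2 * Real.pi * Complex.I / p) ^ (p - (k + 1))) =
      Complex.I ^ m * (Real.sqrt p : ℂ) := by
  set r : ℝ := ∏ k ∈ Finset.range m, (2 * Real.sin (2 * Real.pi * (k + 1) / p)) with hr
  have hp0 : (0 : ℝ) < p := by exact_mod_cast hp.pos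
  have hpc : (p : ℂ) ≠ 0 := by exact_mod_cast hp.ne_zero
  have hrpos : 0 < r := by
    apply Finset.prod_pos
    intro k hk
    have := Finset.mem_range.1 hk
    apply mul_pos two_pos
    apply Real.sin_pos_of_pos_of_lt_pi
    · positivity
    · rw [div_lt_iff₀ hp0]
      have : (2 * (k + 1) : ℝ) < p := by rw [hm]; norm_cast; omega
      nlinarith [Real.pi_pos]
  have hQ : ∏ k ∈ Finset.range m, (Complex.exp (2 * Real.pi * Complex.I / p) ^ (k + 1) -
      Complex.exp (2 * Real.pi * Complex.I / p) ^ (p - (k + 1))) = Complex.I ^ m * (r : ℂ) := by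
    rw [hr, Complex.ofReal_prod]
    rw [qgs_pow_mul_prod]
    apply Finset.prod_congr rfl
    intro k hk
    have := Finset.mem_range.1 hk
    have e1 : Complex.exp (2 * Real.pi * Complex.I / p) ^ (p - (k + 1)) =
        Complex.exp (-(2 * Real.pi * (k + 1) / p) * Complex.I) := by
      rw [← Complex.exp_nat_mul, Complex.exp_eq_exp_iff_exists_int]
      refine ⟨1, ?_⟩
      rw [Nat.cast_sub (by omega)]
      push_cast
      field_simp
      ring
    have e2 : Complex.exp (2 * Real.pi * Complex.I / p) ^ (k + 1) =
        Complex.exp ((2 * Real.pi * (k + 1) / p) * Complex.I) := by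
      rw [← Complex.exp_nat_mul]
      congr 1
      push_cast
      field_simp
    rw [e1, e2]
    push_cast
    rw [Complex.sin]
    linear_combination (Complex.exp ((2 * Real.pi * (k + 1) / p) * Complex.I) -
      Complex.exp (-(2 * Real.pi * (k + 1) / p) * Complex.I)) * Complex.I_mul_I
  have hsq := qgs_Q_sq p m hm hp hm0 _ (Complex.isPrimitiveRoot_exp p hp.ne_zero)
  rw [hQ, mul_pow, ← pow_mul, mul_comm m 2, pow_mul, Complex.I_sq] at hsq
  have h3 : (r : ℂ) ^ 2 = p := mul_left_cancel₀ (pow_ne_zero m (by norm_num)) hsq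
  have h4 : r ^ 2 = p := by exact_mod_cast h3
  rw [hQ, ← h4, Real.sqrt_sq hrpos.le]

lemma qgs_prime_sum (p m : ℕ) [Fact p.Prime] (hm : p = 2 * m + 1) (hm0 : 0 < m) :
    ∑ x : ZMod p, (quadraticChar (ZMod p) x : ℂ) * ZMod.stdAddChar x =
      (quadraticChar (ZMod p) 2 : ℂ) * (-1) ^ m * (Complex.I ^ m * (Real.sqrt p : ℂ)) := by
  have hp : p.Prime := Fact.out
  have hc : ringChar (ZMod p) ≠ 2 := by rw [ZMod.ringChar_zmod_n]; omega
  set ζ : ℂ := Complex.exp (2 * Real.pi * Complex.I / p) with hζd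
  have hζ : IsPrimitiveRoot ζ p := Complex.isPrimitiveRoot_exp p hp.ne_zero
  set g := ∑ x : ZMod p, (quadraticChar (ZMod p) x : ℂ) * ZMod.stdAddChar x with hg
  have hneg : quadraticChar (ZMod p) (-1) = (-1) ^ m := by
    rw [quadraticChar_neg_one hc, ZMod.card, ZMod.χ₄_eq_neg_one_pow (by omega)]
    congr 1; omega
  have hgsq : g ^ 2 = (-1) ^ m * p := by
    have h := gaussSum_sq (R := ZMod p) (R' := ℂ)
      (χ := (quadraticChar (ZMod p)).ringHomComp (Int.castRingHom ℂ))
      ((MulChar.ringHomComp_ne_one_iff (RingHom.injective_int _)).2 (quadraticChar_ne_one hc))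
      ((quadraticChar_isQuadratic (ZMod p)).comp _) (ZMod.isPrimitive_stdAddChar p)
    rw [ZMod.card, MulChar.ringHomComp_apply, hneg] at h
    simpa [gaussSum, hg] using h
  have hgr : g = ∑ j ∈ Finset.range p, ((quadraticChar (ZMod p) (j : ZMod p) : ℤ) : ℂ) * ζ ^ j := by
    symm
    rw [hg]
    apply Finset.sum_bij (fun (j : ℕ) _ => (j : ZMod p))
    · simp
    · intro a ha b hb hab
      have h1 := Finset.mem_range.1 ha
      have h2 := Finset.mem_range.1 hb
      have := congrArg ZMod.val hab
      rwa [ZMod.val_cast_of_lt h1, ZMod.val_cast_of_lt h2] at this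
    · intro x _
      exact ⟨x.val, Finset.mem_range.2 (ZMod.val_lt x), by simp⟩
    · intro j _
      rw [ZMod.stdAddChar_apply, ZMod.toCircle_natCast, hζd, ← Complex.exp_nat_mul]
      congr 2
      ring
  have hQsq := qgs_Q_sq p m hm hp hm0 ζ hζ
  have hQv := qgs_Q_val p m hm hp hm0
  rw [← hζd] at hQv
  have h20 : (2 : ZMod p) ≠ 0 := Ring.two_ne_zero hc
  have key : ∀ ε : ℤ, (ε = 1 ∨ ε = -1) →
      g = ε * ∏ k ∈ Finset.range m, (ζ ^ (k + 1) - ζ ^ (p - (k + 1))) →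
      g = (quadraticChar (ZMod p) 2 : ℂ) * (-1) ^ m * (Complex.I ^ m * (Real.sqrt p : ℂ)) := by
    intro ε hε hgε
    have h1 := qgs_eps p m hm hm0 ε ζ hζ (by rw [← hgr, hgε])
    have h2 : (2 : ZMod p) ^ m = ((quadraticChar (ZMod p) 2 : ℤ) : ZMod p) := by
      rw [quadraticChar_eq_pow_of_char_ne_two' hc, ZMod.card, show p / 2 = m by omega]
    rw [qgs_fact_sq p m hm, h2] at h1
    have h3 : ((ε * quadraticChar (ZMod p) 2 * (-1) ^ m : ℤ) : ZMod p) = ((1 : ℤ) : ZMod p) := by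
      push_cast
      linear_combination -h1
    have hne : ((-1 : ℤ) : ZMod p) ≠ ((1 : ℤ) : ZMod p) := by
      push_cast
      exact Ring.neg_one_ne_one_of_char_ne_two hc
    have h4 : ε = quadraticChar (ZMod p) 2 * (-1) ^ m := by
      rcases hε with rfl | rfl <;> rcases quadraticChar_dichotomy h20 with h | h <;>
        rcases neg_one_pow_eq_or ℤ m with h' | h' <;> rw [h, h'] at h3 ⊢ <;>
        first
          | norm_num; done
          | exact absurd (by simpa using h3) hne
    rw [hgε, hQv, h4]
    push_cast
    ring
  rcases sq_eq_sq_iff_eq_or_eq_neg.1 (hgsq.trans hQsq.symm) with h | h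
  · exact key 1 (Or.inl rfl) (by rw [h]; simp)
  · exact key (-1) (Or.inr rfl) (by rw [h]; simp)

lemma qgs_prime_val (p : ℕ) [Fact p.Prime] (hp2 : p ≠ 2) :
    (p % 4 = 1 → ∑ x : ZMod p, (ZMod.stdAddChar (x ^ 2) : ℂ) = (Real.sqrt p : ℂ)) ∧
    (p % 4 = 3 → ∑ x : ZMod p, (ZMod.stdAddChar (x ^ 2) : ℂ) =
      Complex.I * (Real.sqrt p : ℂ)) := by
  have hp : p.Prime := Fact.out
  have hodd : p % 2 = 1 := hp.eq_two_or_odd.resolve_left hp2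
  have hc : ringChar (ZMod p) ≠ 2 := by rwa [ZMod.ringChar_zmod_n]
  have hψ : (ZMod.stdAddChar : AddChar (ZMod p) ℂ) ≠ 1 := by
    intro h
    have h1 : (1 : ZMod p) = 0 := by
      apply ZMod.injective_stdAddChar
      rw [h]; simp
    exact one_ne_zero h1
  obtain ⟨m, hm⟩ : ∃ m, p = 2 * m + 1 := ⟨p / 2, by omega⟩
  have hm0 : 0 < m := by have := hp.one_lt; omega
  rw [qgs_sum_sq (ZMod p) hc _ hψ, qgs_prime_sum p m hm hm0, quadraticChar_two hc, ZMod.card,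
    ZMod.χ₈_nat_eq_if_mod_eight]
  have hmd : m = 4 * (m / 4) + m % 4 := by omega
  have hI : Complex.I ^ m = Complex.I ^ (m % 4) := by
    rw [hmd, pow_add, pow_mul, Complex.I_pow_four]; simp
  have hN : (-1 : ℂ) ^ m = (-1) ^ (m % 4) := by
    rw [hmd, pow_add, pow_mul]; norm_num
  rw [hI, hN]
  have hlt : m % 4 < 4 := Nat.mod_lt _ (by norm_num)
  constructor
  · intro h4
    have : m % 4 = 0 ∨ m % 4 = 2 := by omega
    rcases this with h | h
    · rw [h, if_neg (by omega), if_pos (by omega)]; simp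
    · rw [h, if_neg (by omega), if_neg (by omega)]; simp
  · intro h4
    have : m % 4 = 1 ∨ m % 4 = 3 := by omega
    rcases this with h | h
    · rw [h, if_neg (by omega), if_neg (by omega)]; simp
    · rw [h, if_neg (by omega), if_pos (by omega)]
      simp [pow_succ]

theorem quadratic_gauss_sum_value (p t : ℕ) (hp : p.Prime) (hodd : Odd p)
    (ht : 0 < t) (F : Type*) [Field F] [Fintype F] [Algebra (ZMod p) F]
    (hcard : Fintype.card F = p ^ t) :
    (p % 4 = 1 →
      ∑ x ∈ Finset.univ.filter (fun x : F => x ≠ 0),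
          (quadChar F x : ℂ) * ePow p (Algebra.trace (ZMod p) F x)
        = (-1) ^ (t - 1) * (Real.sqrt p : ℂ) ^ t) ∧
    (p % 4 = 3 →
      ∑ x ∈ Finset.univ.filter (fun x : F => x ≠ 0),
          (quadChar F x : ℂ) * ePow p (Algebra.trace (ZMod p) F x)
        = (-1) ^ (t - 1) * Complex.I ^ t * (Real.sqrt p : ℂ) ^ t) := by
  have hfact : Fact p.Prime := ⟨hp⟩
  have hp2 : p ≠ 2 := by rintro rfl; exact absurd hodd (by decide)
  have hchar : CharP F p := charP_of_injective_algebraMap (algebraMap (ZMod p) F).injective p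
  have hcF : ringChar F ≠ 2 := by rwa [ringChar.eq F p]
  have hfin : Module.finrank (ZMod p) F = t := by
    have h := Module.card_eq_pow_finrank (K := ZMod p) (V := F)
    rw [ZMod.card, hcard] at h
    exact (Nat.pow_right_injective hp.two_le h).symm
  have hψ : (ZMod.stdAddChar : AddChar (ZMod p) ℂ) ≠ 1 := by
    intro h
    have h1 : (1 : ZMod p) = 0 := by
      apply ZMod.injective_stdAddChar
      rw [h]; simp
    exact one_ne_zero h1
  set Ψ : AddChar F ℂ :=
    (ZMod.stdAddChar : AddChar (ZMod p) ℂ).compAddMonoidHom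
      (Algebra.trace (ZMod p) F).toAddMonoidHom with hΨd
  have hΨa : ∀ x, Ψ x = ZMod.stdAddChar (Algebra.trace (ZMod p) F x) := fun x => rfl
  have hΨ : Ψ ≠ 1 := by
    intro h
    obtain ⟨x, hx⟩ := Algebra.trace_surjective (ZMod p) F 1
    have h1 : (1 : ZMod p) = 0 := by
      apply ZMod.injective_stdAddChar
      rw [← hx, ← hΨa, h]; simp
    exact one_ne_zero h1
  have hq : ∀ x : F, quadChar F x = quadraticChar F x := by
    intro x
    rw [quadraticChar_apply, quadraticCharFun, quadChar]
  have hS : ∑ x ∈ Finset.univ.filter (fun x : F => x ≠ 0),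
      (quadChar F x : ℂ) * ePow p (Algebra.trace (ZMod p) F x) =
      (-1) ^ (t - 1) * (∑ x : ZMod p, (ZMod.stdAddChar (x ^ 2) : ℂ)) ^ t := by
    rw [← qgs_lift p t hp2 F hfin _ hψ]
    have h1 := qgs_sum_sq F hcF Ψ hΨ
    simp only [hΨa] at h1
    rw [h1, Finset.sum_filter]
    apply Finset.sum_congr rfl
    intro x _
    rw [hq, ZMod.stdAddChar_apply, ZMod.toCircle_apply, ePow]
    by_cases hx : x = 0
    · simp [hx]
    · simp [hx]
  obtain ⟨hA, hB⟩ := qgs_prime_val p hp2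
  constructor
  · intro h4
    rw [hS, hA h4]
  · intro h4
    rw [hS, hB h4, mul_pow, mul_assoc]
end

section
/- Let p be an odd prime, m, k positive integers with e = gcd(k,m), m/e ≥ 3 odd, and T(u,v) = ∑_{x ∈ F_{p^m}} ω_p^{Tr(u x^{p^k+1} + v x²)} where Tr is the absolute trace. Then for each ε ∈ {1, −1}, the number of u ∈ F_{p^m}^* with T(u,1) = ε p^{(m+e)/2} equals (p^{m−e} + ε p^{(m−e)/2})/2. -/
open scoped Classical

section Aux

variable {K : Type*} [Field K] [Fintype K]

lemma gauss_one_dim (h2 : ringChar K ≠ 2) (ψ : AddChar K ℂ) (hψ : ψ.IsPrimitive) :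
    ∃ g : ℂ, (∃ s : ℤ, (s = 1 ∨ s = -1) ∧ g ^ 2 = s * (Fintype.card K : ℂ)) ∧
      ∀ w : K, w ≠ 0 → ∑ a : K, ψ (w * a ^ 2) = (quadraticChar K w : ℂ) * g := by
  set χ : MulChar K ℂ := (quadraticChar K).ringHomComp (Int.castRingHom ℂ) with hχ
  have hinj : Function.Injective (Int.castRingHom ℂ) := Int.cast_injective
  have hχ1 : χ ≠ 1 := (MulChar.ringHomComp_ne_one_iff hinj).mpr (quadraticChar_ne_one h2)
  have hχ2 : χ.IsQuadratic := (quadraticChar_isQuadratic K).comp _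
  refine ⟨gaussSum χ ψ, ⟨quadraticChar K (-1), quadraticChar_dichotomy (by simp), ?_⟩, ?_⟩
  · rw [gaussSum_sq hχ1 hχ2 hψ]
    simp [hχ, MulChar.ringHomComp_apply]
  · intro w hw
    have h1 : ∑ a : K, ψ (w * a ^ 2) = ∑ b : K, (1 + χ b) * ψ (w * b) := by
      rw [← Finset.sum_fiberwise (s := Finset.univ) (g := fun a : K => a ^ 2)]
      refine Finset.sum_congr rfl fun b _ => ?_
      rw [Finset.sum_congr rfl (g := fun _ => ψ (w * b))
        (fun a ha => by rw [(Finset.mem_filter.mp ha).2])]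
      rw [Finset.sum_const, nsmul_eq_mul]
      congr 1
      have := quadraticChar_card_sqrts h2 b
      have h3 : {x : K | x ^ 2 = b}.toFinset = Finset.univ.filter (fun a : K => a ^ 2 = b) := by
        ext; simp
      rw [h3] at this
      have h4 := congrArg (Int.cast : ℤ → ℂ) this
      push_cast at h4
      rw [h4, add_comm]; rfl
    rw [h1]
    simp_rw [add_mul, one_mul, Finset.sum_add_distrib]
    have h5 : ∑ b : K, ψ (w * b) = 0 := by
      have := AddChar.sum_mulShift (ψ := ψ) w hψ
      simp only [hw, if_false] at this
      simpa [mul_comm] using this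
    rw [h5, zero_add]
    have h6 := gaussSum_mulShift χ ψ (Units.mk0 w hw)
    have h7 : (χ w) * χ w = 1 := by
      have := quadraticChar_sq_one hw
      have h := congrArg (Int.cast : ℤ → ℂ) this
      push_cast at h
      rw [← sq]; exact h
    have h8 : ∑ b : K, χ b * ψ (w * b) = gaussSum χ (ψ.mulShift w) := rfl
    rw [h8, ← h6]
    change _ = χ w * (χ w * _)
    rw [← mul_assoc, h7, one_mul]
    rfl

lemma addChar_sum {ι : Type*} (ψ : AddChar K ℂ) (s : Finset ι) (f : ι → K) :
    ψ (∑ i ∈ s, f i) = ∏ i ∈ s, ψ (f i) := by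
  induction s using Finset.induction_on with
  | empty => simp
  | insert a s ha ih => rw [Finset.sum_insert ha, Finset.prod_insert ha, AddChar.map_add_eq_mul, ih]

lemma quad_sum {V : Type*} [AddCommGroup V] [Module K V] [FiniteDimensional K V] [Fintype V]
    (h2 : ringChar K ≠ 2) (ψ : AddChar K ℂ) (g : ℂ)
    (hg : ∀ w : K, w ≠ 0 → ∑ a : K, ψ (w * a ^ 2) = (quadraticChar K w : ℂ) * g)
    (Q : QuadraticForm K V) :
    ∃ d : ℕ, ∃ δ : ℤ, d ≤ Module.finrank K V ∧ (δ = 1 ∨ δ = -1) ∧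
      (Finset.univ.filter (fun x : V => ∀ y, QuadraticMap.polar Q x y = 0)).card
        = Fintype.card K ^ d ∧
      ∀ c : K, c ≠ 0 → ∑ x : V, ψ (c * Q x) =
        (quadraticChar K c : ℂ) ^ (Module.finrank K V - d) * δ * (Fintype.card K : ℂ) ^ d *
          g ^ (Module.finrank K V - d) := by
  have h2' : (2 : K) ≠ 0 := Ring.two_ne_zero h2
  have : Invertible (2 : K) := invertibleOfNonzero h2'
  have key := QuadraticForm.equivalent_weightedSumSquares Q
  generalize Module.finrank K V = n at key ⊢
  obtain ⟨w, ⟨φ⟩⟩ := key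
  have hQ : ∀ x, Q x = ∑ i, w i * (φ x i) ^ 2 := by
    intro x
    rw [← φ.map_app x, QuadraticMap.weightedSumSquares_apply]
    simp [sq]
  set Z := Finset.univ.filter (fun i : Fin n => w i = 0) with hZ
  set NZ := Finset.univ.filter (fun i : Fin n => ¬ w i = 0) with hNZ
  have hcard : Z.card + NZ.card = n := by
    rw [hZ, hNZ, Finset.card_filter_add_card_filter_not]; simp
  have hNZc : n - Z.card = NZ.card := by omega
  have hprod : ∏ i ∈ NZ, quadraticChar K (w i) = 1 ∨ ∏ i ∈ NZ, quadraticChar K (w i) = -1 := by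
    rw [← map_prod]
    apply quadraticChar_dichotomy
    rw [Finset.prod_ne_zero_iff]
    intro i hi
    exact (Finset.mem_filter.mp hi).2
  refine ⟨Z.card, ∏ i ∈ NZ, quadraticChar K (w i), by omega, hprod, ?_, ?_⟩
  · have hpol : ∀ x y, QuadraticMap.polar Q x y = ∑ i, 2 * w i * φ x i * φ y i := by
      intro x y
      rw [QuadraticMap.polar, hQ, hQ, hQ, ← Finset.sum_sub_distrib, ← Finset.sum_sub_distrib]
      refine Finset.sum_congr rfl fun i _ => ?_
      have : φ (x + y) = φ x + φ y := map_add φ.toLinearEquiv x y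
      rw [this, Pi.add_apply]; ring
    have hrad : ∀ x, (∀ y, QuadraticMap.polar Q x y = 0) ↔ ∀ i, w i * φ x i = 0 := by
      intro x
      constructor
      · intro h i
        have := h (φ.toLinearEquiv.symm (Pi.single i 1))
        rw [hpol] at this
        have h3 : φ (φ.toLinearEquiv.symm (Pi.single i 1)) = Pi.single i 1 :=
          φ.toLinearEquiv.apply_symm_apply _
        rw [h3] at this
        rw [Finset.sum_eq_single i] at this
        · simp only [Pi.single_eq_same, mul_one, mul_assoc] at this
          exact (mul_eq_zero.mp this).resolve_left h2'
        · intro j _ hj; simp [hj]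
        · simp
      · intro h y
        rw [hpol]
        refine Finset.sum_eq_zero fun i _ => ?_
        rw [mul_assoc 2, h i]; simp
    have : (Finset.univ.filter (fun x : V => ∀ y, QuadraticMap.polar Q x y = 0)).card =
        (Fintype.piFinset (fun i : Fin n => if w i = 0 then (Finset.univ : Finset K) else {0})).card := by
      refine Finset.card_bij (fun x _ => φ x) ?_ ?_ ?_
      · intro x hx
        rw [Finset.mem_filter, hrad] at hx
        rw [Fintype.mem_piFinset]
        intro i
        have := hx.2 i
        split_ifs with h
        · simp
        · simpa [h] using this
      · intro x _ y _ h
        exact φ.toLinearEquiv.injective h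
      · intro v hv
        refine ⟨φ.toLinearEquiv.symm v, ?_, φ.toLinearEquiv.apply_symm_apply _⟩
        have h3 : φ (φ.toLinearEquiv.symm v) = v := φ.toLinearEquiv.apply_symm_apply _
        rw [Finset.mem_filter, hrad, h3]
        refine ⟨Finset.mem_univ _, fun i => ?_⟩
        have := Fintype.mem_piFinset.mp hv i
        split_ifs at this with h
        · simp [h]
        · simp at this; simp [this]
    rw [this, Fintype.card_piFinset, ← Finset.prod_filter_mul_prod_filter_not _ (fun i => w i = 0)]
    rw [Finset.prod_congr rfl (g := fun _ => Fintype.card K), Finset.prod_const,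
      Finset.prod_eq_one, mul_one]
    · intro i hi
      simp [(Finset.mem_filter.mp hi).2]
    · intro i hi
      simp [(Finset.mem_filter.mp hi).2]
  · intro c hc
    have e1 : ∑ x : V, ψ (c * Q x) = ∑ v : Fin n → K, ∏ i, ψ (c * w i * v i ^ 2) := by
      refine Fintype.sum_equiv φ.toLinearEquiv.toEquiv _ _ fun x => ?_
      rw [hQ, Finset.mul_sum, addChar_sum]
      refine Finset.prod_congr rfl fun i _ => ?_
      rw [← mul_assoc]; rfl
    have e2 : ∑ v : Fin n → K, ∏ i, ψ (c * w i * v i ^ 2) = ∏ i, ∑ a : K, ψ (c * w i * a ^ 2) := by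
      rw [Finset.prod_univ_sum, Fintype.piFinset_univ]
    rw [e1, e2, ← Finset.prod_filter_mul_prod_filter_not _ (fun i => w i = 0)]
    rw [Finset.prod_congr rfl (g := fun _ => (Fintype.card K : ℂ)), Finset.prod_const,
      Finset.prod_congr (s₁ := NZ) rfl
        (g := fun i => (quadraticChar K c : ℂ) * (quadraticChar K (w i) : ℂ) * g)]
    · rw [Finset.prod_mul_distrib, Finset.prod_mul_distrib, Finset.prod_const, Finset.prod_const,
        hNZc]
      push_cast
      ring
    · intro i hi
      rw [hg _ (mul_ne_zero hc (Finset.mem_filter.mp hi).2), map_mul]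
      push_cast; ring
    · intro i hi
      simp [(Finset.mem_filter.mp hi).2]

end Aux

section Rad

variable {K F : Type*} [Field K] [Fintype K] [Field F] [Fintype F] [Algebra K F]

/-- The radical of the quadratic form `Tr (u x σ(x) + x ^ 2)`. -/
noncomputable def radS (σ : F ≃ₐ[K] F) (u : F) : Finset F :=
  Finset.univ.filter (fun z => σ u * σ (σ z) + 2 * σ z + u * z = 0)

/-- The image of `σ - 1`. -/
noncomputable def imS (σ : F ≃ₐ[K] F) : Finset F :=
  Finset.univ.image (fun t : F => σ t - t)

lemma theta_inj (σ : F ≃ₐ[K] F) (h2 : (2 : F) ≠ 0) {N : ℕ} (hN : Odd N)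
    (hσ : ∀ x : F, σ^[N] x = x) : Function.Injective (fun w : F => w + σ w) := by
  have h0 : ∀ w : F, w + σ w = 0 → w = 0 := by
    intro w hw
    have h1 : σ w = -w := by linear_combination hw
    have h3 : ∀ j : ℕ, σ^[j] w = (-1) ^ j * w := by
      intro j
      induction j with
      | zero => simp
      | succ j ih => rw [Function.iterate_succ_apply', ih, map_mul, h1]; simp; ring
    have h4 := h3 N
    rw [hσ, hN.neg_one_pow] at h4
    have : 2 * w = 0 := by linear_combination h4
    exact (mul_eq_zero.mp this).resolve_left h2
  intro a b hab
  have := h0 (a - b) (by simp only [map_sub]; simp only at hab; linear_combination hab)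
  exact sub_eq_zero.mp this

lemma card_imS (σ : F ≃ₐ[K] F) (hfix : ∀ x : F, σ x = x → ∃ a : K, algebraMap K F a = x) :
    (imS σ).card * Fintype.card K = Fintype.card F := by
  have : ∀ s ∈ imS σ, ((Finset.univ : Finset F).filter (fun t => σ t - t = s)).card = Fintype.card K := by
    intro s hs
    obtain ⟨t0, -, rfl⟩ := Finset.mem_image.mp hs
    symm
    refine Finset.card_bij (fun a _ => t0 + algebraMap K F a) ?_ ?_ ?_
    · intro a _
      simp
    · intro a _ b _ h
      exact (algebraMap K F).injective (add_left_cancel h)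
    · intro t ht
      have ht := (Finset.mem_filter.mp ht).2
      obtain ⟨a, ha⟩ := hfix (t - t0) (by rw [map_sub]; linear_combination ht)
      exact ⟨a, Finset.mem_univ _, by rw [ha]; ring⟩
  have h := Finset.card_eq_sum_card_image (fun t : F => σ t - t) Finset.univ
  rw [Finset.card_univ] at h
  rw [h]
  change _ = ∑ s ∈ imS σ, _
  rw [Finset.sum_congr rfl this, Finset.sum_const, smul_eq_mul]

/-- Size of the radical when it contains `x ≠ 0`. -/
lemma card_radS (σ : F ≃ₐ[K] F) (h2 : (2 : F) ≠ 0) {N : ℕ} (hN : Odd N)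
    (hσ : ∀ x : F, σ^[N] x = x) (hfix : ∀ x : F, σ x = x → ∃ a : K, algebraMap K F a = x)
    (u x : F) (hx : x ≠ 0) (hxu : x ∈ radS σ u) :
    (radS σ u).card = if (u * x * σ x)⁻¹ ∈ imS σ then Fintype.card K ^ 2 else Fintype.card K := by
  set w := u * x * σ x with hw
  have hσx : σ x ≠ 0 := by simpa using hx
  have hxu' : σ u * σ (σ x) + 2 * σ x + u * x = 0 := (Finset.mem_filter.mp hxu).2
  have hw0 : w ≠ 0 := by
    intro h
    have hu : u = 0 := by
      rcases mul_eq_zero.mp h with h | h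
      · exact (mul_eq_zero.mp h).resolve_right hx
      · exact absurd h hσx
    rw [hu] at hxu'
    simp at hxu'
    exact hxu'.elim h2 hx
  have hθ : w + σ w = - 2 * (σ x) ^ 2 := by
    simp only [hw, map_mul]; linear_combination (σ x) * hxu'
  have hmem : ∀ t, x * t ∈ radS σ u ↔ ∃ a : K, algebraMap K F a = w * (σ t - t) := by
    intro t
    have e : σ x * (σ u * σ (σ (x * t)) + 2 * σ (x * t) + u * (x * t)) =
        σ (w * (σ t - t)) - w * (σ t - t) := by
      have : σ w = -w - 2 * (σ x) ^ 2 := by linear_combination hθ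
      have h5 : σ x * (σ u * σ (σ (x * t)) + 2 * σ (x * t) + u * (x * t))
         = σ w * σ (σ t) + 2 * (σ x) ^ 2 * σ t + w * t := by
        simp only [hw, map_mul]; ring
      rw [h5, map_mul σ w, map_sub]
      linear_combination (σ t) * this
    rw [radS, Finset.mem_filter]
    constructor
    · rintro ⟨-, h⟩
      rw [h, mul_zero] at e
      exact hfix _ (sub_eq_zero.mp e.symm)
    · rintro ⟨a, ha⟩
      refine ⟨Finset.mem_univ _, ?_⟩
      rw [← ha] at e
      simp only [AlgEquiv.commutes, sub_self] at e
      exact (mul_eq_zero.mp e).resolve_left hσx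
  split_ifs with him
  · obtain ⟨t0, -, ht0⟩ := Finset.mem_image.mp him
    rw [sq, ← Fintype.card_prod, ← Finset.card_univ]
    symm
    refine Finset.card_bij (fun ab _ => x * (algebraMap K F ab.1 * t0 + algebraMap K F ab.2)) ?_ ?_ ?_
    · intro ab _
      rw [hmem]
      refine ⟨ab.1, ?_⟩
      simp only [map_add, map_mul, AlgEquiv.commutes]
      have : w * (σ t0 - t0) = 1 := by rw [ht0, mul_inv_cancel₀ hw0]
      linear_combination (-algebraMap K F ab.1) * this
    · rintro ⟨a, b⟩ _ ⟨c, d⟩ _ h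
      have h := mul_left_cancel₀ hx h
      simp only at h
      have h' := congrArg σ h
      simp only [map_add, map_mul, AlgEquiv.commutes] at h'
      have : w * (σ t0 - t0) = 1 := by rw [ht0, mul_inv_cancel₀ hw0]
      have hac : algebraMap K F a = algebraMap K F c := by
        linear_combination w * (h' - h) - (algebraMap K F a - algebraMap K F c) * this
      have hbd : algebraMap K F b = algebraMap K F d := by
        linear_combination h - t0 * hac
      rw [(algebraMap K F).injective hac, (algebraMap K F).injective hbd]
    · intro z hz
      obtain ⟨t, rfl⟩ : ∃ t, z = x * t := ⟨z / x, by field_simp⟩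
      obtain ⟨a, ha⟩ := (hmem t).mp hz
      have : w * (σ t0 - t0) = 1 := by rw [ht0, mul_inv_cancel₀ hw0]
      obtain ⟨b, hb⟩ := hfix (t - algebraMap K F a * t0) (by
        simp only [map_sub, map_mul, AlgEquiv.commutes]
        apply mul_left_cancel₀ hw0
        linear_combination -ha - (algebraMap K F a) * this)
      exact ⟨(a, b), Finset.mem_univ _, by simp only; rw [hb]; ring⟩
  · rw [← Finset.card_univ]
    symm
    refine Finset.card_bij (fun a _ => x * algebraMap K F a) ?_ ?_ ?_
    · intro a _
      rw [hmem]
      exact ⟨0, by simp⟩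
    · intro a _ b _ h
      exact (algebraMap K F).injective (mul_left_cancel₀ hx h)
    · intro z hz
      obtain ⟨t, rfl⟩ : ∃ t, z = x * t := ⟨z / x, by field_simp⟩
      obtain ⟨a, ha⟩ := (hmem t).mp hz
      by_cases ha0 : a = 0
      · rw [ha0, map_zero] at ha
        obtain ⟨b, hb⟩ := hfix t (sub_eq_zero.mp ((mul_eq_zero.mp ha.symm).resolve_left hw0))
        exact ⟨b, Finset.mem_univ _, by rw [hb]⟩
      · exfalso
        apply him
        have ha0' : algebraMap K F a ≠ 0 := by simpa using ha0
        refine Finset.mem_image.mpr ⟨algebraMap K F a⁻¹ * t, Finset.mem_univ _, ?_⟩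
        simp only [map_mul, AlgEquiv.commutes, map_inv₀]
        field_simp
        linear_combination -ha

lemma card_sq_pairs (σ : F ≃ₐ[K] F) (hF2 : ringChar F ≠ 2) {N : ℕ} (hN : Odd N)
    (hσ : ∀ x : F, σ^[N] x = x) (c : K) (hc : ¬ IsSquare (algebraMap K F c)) :
    ((Finset.univ : Finset (F × F)).filter (fun wx : F × F => wx.1⁻¹ ∉ imS σ ∧
      wx.1 + σ wx.1 = -2 * (σ wx.2) ^ 2)).card = Fintype.card F - (imS σ).card := by
  have h2 : (2 : F) ≠ 0 := Ring.two_ne_zero hF2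
  have hinj := theta_inj σ h2 hN hσ
  have h0im : (0 : F) ∈ imS σ := Finset.mem_image.mpr ⟨0, Finset.mem_univ _, by simp⟩
  have hc0 : algebraMap K F c ≠ 0 := by
    intro h; rw [h] at hc; exact hc ⟨0, by simp⟩
  have hcim : ∀ s, algebraMap K F c * s ∈ imS σ ↔ s ∈ imS σ := by
    intro s
    constructor
    · intro h
      obtain ⟨t, -, ht⟩ := Finset.mem_image.mp h
      refine Finset.mem_image.mpr ⟨algebraMap K F c⁻¹ * t, Finset.mem_univ _, ?_⟩
      simp only [map_mul, AlgEquiv.commutes, map_inv₀] at ht ⊢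
      field_simp
      linear_combination ht
    · intro h
      obtain ⟨t, -, ht⟩ := Finset.mem_image.mp h
      refine Finset.mem_image.mpr ⟨algebraMap K F c * t, Finset.mem_univ _, ?_⟩
      simp only [map_mul, AlgEquiv.commutes] at ht ⊢
      linear_combination (algebraMap K F c) * ht
  -- the set of admissible w
  set W := (Finset.univ : Finset F).filter (fun w => w⁻¹ ∉ imS σ) with hW
  have hWcard : W.card = Fintype.card F - (imS σ).card := by
    have : W.card = (imS σ)ᶜ.card := by
      refine Finset.card_bij (fun w _ => w⁻¹) ?_ ?_ ?_
      · intro w hw; simpa [hW] using hw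
      · intro a _ b _ h; exact inv_injective h
      · intro v hv; exact ⟨v⁻¹, by simpa [hW] using hv, by simp⟩
    rw [this, Finset.card_compl]
  have hfib : ∀ w : F, (((Finset.univ : Finset F).filter (fun x => w + σ w = -2 * (σ x) ^ 2)).card : ℤ)
      = quadraticChar F (-(w + σ w) / 2) + 1 := by
    intro w
    rw [← quadraticChar_card_sqrts hF2]
    congr 1
    refine Finset.card_bij (fun x _ => σ x) ?_ ?_ ?_
    · intro x hx
      have hx := (Finset.mem_filter.mp hx).2
      simp only [Set.mem_toFinset, Set.mem_ofPred_eq]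
      rw [hx]; field_simp
    · intro a _ b _ h; exact σ.injective h
    · intro y hy
      simp only [Set.mem_toFinset, Set.mem_ofPred_eq] at hy
      refine ⟨σ.symm y, ?_, by simp⟩
      simp only [Finset.mem_filter, Finset.mem_univ, true_and, AlgEquiv.apply_symm_apply]
      rw [hy]; field_simp
  have hsum0 : ∑ w ∈ W, quadraticChar F (-(w + σ w) / 2) = 0 := by
    have : ∑ w ∈ W, quadraticChar F (-(w + σ w) / 2)
        = ∑ w ∈ W, - quadraticChar F (-(w + σ w) / 2) := by
      refine Finset.sum_bij' (fun w _ => (algebraMap K F c)⁻¹ * w) (fun w _ => algebraMap K F c * w) ?_ ?_ ?_ ?_ ?_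
      · intro w hw
        simp only [hW, Finset.mem_filter, Finset.mem_univ, true_and] at hw ⊢
        rw [mul_inv, inv_inv, hcim]; exact hw
      · intro w hw
        simp only [hW, Finset.mem_filter, Finset.mem_univ, true_and] at hw ⊢
        rw [← hcim, mul_inv, ← mul_assoc, mul_inv_cancel₀ hc0, one_mul]; exact hw
      · intro w _; field_simp
      · intro w _; field_simp
      · intro w _
        have e : -(w + σ w) / 2 = algebraMap K F c *
            (-((algebraMap K F c)⁻¹ * w + σ ((algebraMap K F c)⁻¹ * w)) / 2) := by
          simp only [map_mul, map_inv₀, AlgEquiv.commutes]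
          field_simp
        conv_lhs => rw [e, map_mul, quadraticChar_neg_one_iff_not_isSquare.mpr hc]
        ring
    rw [Finset.sum_neg_distrib] at this
    omega
  have hmain : (((Finset.univ : Finset (F × F)).filter (fun wx : F × F => wx.1⁻¹ ∉ imS σ ∧
      wx.1 + σ wx.1 = -2 * (σ wx.2) ^ 2)).card : ℤ) = W.card := by
    have : ((Finset.univ : Finset (F × F)).filter (fun wx : F × F => wx.1⁻¹ ∉ imS σ ∧
      wx.1 + σ wx.1 = -2 * (σ wx.2) ^ 2)).card =
      ∑ w ∈ W, ((Finset.univ : Finset F).filter (fun x => w + σ w = -2 * (σ x) ^ 2)).card := by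
      rw [← Finset.card_sigma]
      refine Finset.card_bij (fun a _ => ⟨a.1, a.2⟩) ?_ ?_ ?_
      · rintro ⟨a, b⟩ h; simpa [hW] using h
      · rintro ⟨a, b⟩ _ ⟨c, d⟩ _ h; simpa using h
      · rintro ⟨a, b⟩ h; exact ⟨(a, b), by simpa [hW] using h, rfl⟩
    rw [this]
    push_cast
    rw [Finset.sum_congr rfl (fun w _ => hfib w), Finset.sum_add_distrib, hsum0]
    simp
  rw [← hWcard]
  exact_mod_cast hmain

lemma count_rad (σ : F ≃ₐ[K] F) (hF2 : ringChar F ≠ 2) {N : ℕ} (hN : Odd N)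
    (hσ : ∀ x : F, σ^[N] x = x) (hfix : ∀ x : F, σ x = x → ∃ a : K, algebraMap K F a = x)
    (c : K) (hc : ¬ IsSquare (algebraMap K F c)) :
    ((Finset.univ : Finset F).filter (fun u => (radS σ u).card = Fintype.card K)).card
      = (imS σ).card := by
  have h2 : (2 : F) ≠ 0 := Ring.two_ne_zero hF2
  have hq : 1 < Fintype.card K := Fintype.one_lt_card
  have h0im : (0 : F) ∈ imS σ := Finset.mem_image.mpr ⟨0, Finset.mem_univ _, by simp⟩
  have h0r : ∀ u, (0 : F) ∈ radS σ u := fun u => by simp [radS]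
  set A := (Finset.univ : Finset F).filter (fun u => (radS σ u).card = Fintype.card K) with hA
  have h1 : (A.sigma (fun u => (radS σ u).erase 0)).card = A.card * (Fintype.card K - 1) := by
    rw [Finset.card_sigma, Finset.sum_congr rfl (g := fun _ => Fintype.card K - 1),
      Finset.sum_const, smul_eq_mul]
    intro u hu
    rw [Finset.card_erase_of_mem (h0r u), (Finset.mem_filter.mp hu).2]
  have h3 : (A.sigma (fun u => (radS σ u).erase 0)).card = Fintype.card F - (imS σ).card := by
    rw [← card_sq_pairs σ hF2 hN hσ c hc]
    have hth : ∀ u x : F, x ≠ 0 → (x ∈ radS σ u ↔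
        u * x * σ x + σ (u * x * σ x) = -2 * (σ x) ^ 2) := by
      intro u x hx
      have hσx : σ x ≠ 0 := by simpa using hx
      simp only [radS, Finset.mem_filter, Finset.mem_univ, true_and, map_mul]
      constructor
      · intro h; linear_combination (σ x) * h
      · intro h; apply mul_left_cancel₀ hσx; linear_combination h
    have hne : Fintype.card K ^ 2 ≠ Fintype.card K := by nlinarith
    refine Finset.card_bij (fun ux _ => (ux.1 * ux.2 * σ ux.2, ux.2)) ?_ ?_ ?_
    · rintro ⟨u, x⟩ h
      simp only [Finset.mem_sigma, Finset.mem_erase] at h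
      obtain ⟨hu, hx0, hx⟩ := h
      simp only [Finset.mem_filter, Finset.mem_univ, true_and]
      refine ⟨?_, (hth u x hx0).mp hx⟩
      intro him
      have := card_radS σ h2 hN hσ hfix u x hx0 hx
      rw [if_pos him, (Finset.mem_filter.mp hu).2] at this
      exact hne this.symm
    · rintro ⟨u, x⟩ h ⟨v, y⟩ h' hh
      simp only [Finset.mem_sigma, Finset.mem_erase] at h
      obtain ⟨hu, hx0, hx⟩ := h
      have hσx : σ x ≠ 0 := by simpa using hx0
      simp only [Prod.mk.injEq] at hh
      obtain ⟨h1, rfl⟩ := hh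
      have := mul_right_cancel₀ hx0 (mul_right_cancel₀ hσx h1)
      rw [this]
    · rintro ⟨w, x⟩ h
      simp only [Finset.mem_filter, Finset.mem_univ, true_and] at h
      obtain ⟨him, hθ⟩ := h
      have hx0 : x ≠ 0 := by
        rintro rfl
        have hw : w = 0 := theta_inj σ h2 hN hσ (by simpa using hθ)
        rw [hw] at him
        simp [h0im] at him
      have hσx : σ x ≠ 0 := by simpa using hx0
      have e : w * x⁻¹ * (σ x)⁻¹ * x * σ x = w := by field_simp
      have hx : x ∈ radS σ (w * x⁻¹ * (σ x)⁻¹) := by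
        rw [hth _ _ hx0, e]; exact hθ
      refine ⟨⟨w * x⁻¹ * (σ x)⁻¹, x⟩, ?_, by simp only [e]⟩
      simp only [Finset.mem_sigma, Finset.mem_erase]
      refine ⟨?_, hx0, hx⟩
      have := card_radS σ h2 hN hσ hfix _ x hx0 hx
      rw [e, if_neg him] at this
      simp [hA, this]
  rw [h1, ← card_imS σ hfix] at h3
  have : (imS σ).card * Fintype.card K - (imS σ).card = (imS σ).card * (Fintype.card K - 1) := by
    rw [Nat.mul_sub, mul_one]
  rw [this] at h3
  exact Nat.eq_of_mul_eq_mul_right (by omega) h3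

end Rad

section Main

variable {K F : Type*} [Field K] [Fintype K] [Field F] [Fintype F] [Algebra K F]

/-- The quadratic form `Tr (u x σ(x) + x ^ 2)`. -/
noncomputable def formS (σ : F ≃ₐ[K] F) (u : F) : QuadraticForm K F :=
  LinearMap.BilinMap.toQuadraticMap (LinearMap.mk₂ K
    (fun x y : F => Algebra.trace K F (u * x * σ y + x * y))
    (fun a b c => by rw [← map_add]; congr 1; ring)
    (fun r a b => by
      rw [← map_smul]; congr 1; simp only [Algebra.smul_def]; ring)
    (fun a b c => by rw [← map_add]; congr 1; rw [map_add]; ring)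
    (fun r a b => by
      rw [← map_smul]; congr 1; simp only [Algebra.smul_def, map_mul, AlgEquiv.commutes]; ring))

lemma formS_apply (σ : F ≃ₐ[K] F) (u x : F) :
    formS σ u x = Algebra.trace K F (u * x * σ x + x * x) := rfl

lemma formS_rad (σ : F ≃ₐ[K] F) (u : F) :
    (Finset.univ.filter (fun x : F => ∀ y, QuadraticMap.polar (formS σ u) x y = 0)) = radS σ u := by
  ext x
  simp only [radS, Finset.mem_filter, Finset.mem_univ, true_and]
  have hp : ∀ y, QuadraticMap.polar (formS σ u) x y =
      Algebra.trace K F ((σ u * σ (σ x) + 2 * σ x + u * x) * σ y) := by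
    intro y
    have e1 : QuadraticMap.polar (formS σ u) x y =
        Algebra.trace K F (u * σ x * y + 2 * x * y) + Algebra.trace K F (u * x * σ y) := by
      simp only [QuadraticMap.polar, formS_apply]
      rw [← map_sub, ← map_sub, ← map_add]
      congr 1
      rw [map_add]; ring
    rw [e1, ← Algebra.trace_eq_of_algEquiv σ (u * σ x * y + 2 * x * y), ← map_add]
    congr 1
    simp only [map_add, map_mul, map_ofNat]
    ring
  constructor
  · intro h
    apply (traceForm_nondegenerate K F).1
    intro z
    rw [Algebra.traceForm_apply]
    have := hp (σ.symm z)
    rw [h, AlgEquiv.apply_symm_apply] at this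
    exact this.symm
  · intro h y
    rw [hp, h]; simp

lemma sum_u (σ : F ≃ₐ[K] F) (ψ : AddChar K ℂ) (hψ : ψ.IsPrimitive) (c : K) :
    ∑ u : F, ∑ x : F, ψ (Algebra.trace K F (u * x * σ x + algebraMap K F c * (x * x)))
      = Fintype.card F := by
  rw [Finset.sum_comm]
  rw [Finset.sum_eq_single 0]
  · simp
  · intro x _ hx
    have hσx : σ x ≠ 0 := by simpa using hx
    set Ψ : AddChar F ℂ := ψ.compAddMonoidHom (Algebra.trace K F).toAddMonoidHom with hΨ
    have hΨ1 : Ψ ≠ 1 := by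
      intro h
      have hψ1 : ψ ≠ 1 := by
        have := hψ one_ne_zero
        rwa [AddChar.mulShift_one] at this
      apply hψ1
      ext a
      obtain ⟨b, rfl⟩ := Algebra.trace_surjective K F a
      exact DFunLike.congr_fun h b
    have h0 := AddChar.sum_eq_zero_of_ne_one hΨ1
    have : ∀ u : F, ψ (Algebra.trace K F (u * x * σ x + algebraMap K F c * (x * x)))
        = Ψ (u * (x * σ x)) * Ψ (algebraMap K F c * (x * x)) := by
      intro u
      rw [← AddChar.map_add_eq_mul, ← mul_assoc u x]; rfl
    rw [Finset.sum_congr rfl (fun u _ => this u), ← Finset.sum_mul]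
    have h3 : ∑ u : F, Ψ (u * (x * σ x)) = ∑ u : F, Ψ u :=
      Fintype.sum_equiv (Equiv.mulRight₀ (x * σ x) (mul_ne_zero hx hσx)) _ _ (fun u => rfl)
    rw [h3, h0, zero_mul]
  · simp

lemma abstract_main (σ : F ≃ₐ[K] F) (hF2 : ringChar F ≠ 2) (hK2 : ringChar K ≠ 2)
    {N : ℕ} (hN : Odd N)
    (hσ : ∀ x : F, σ^[N] x = x) (hfix : ∀ x : F, σ x = x → ∃ a : K, algebraMap K F a = x)
    (ψ : AddChar K ℂ) (hψ : ψ.IsPrimitive) (j : ℕ) (hj : Module.finrank K F = 2 * j + 1)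
    (ε : ℤ) (hε : ε = 1 ∨ ε = -1) :
    2 * ((Finset.univ.filter (fun u : F => u ≠ 0 ∧
      ∑ x : F, ψ (Algebra.trace K F (u * x * σ x + x * x))
        = (ε : ℂ) * (Fintype.card K : ℂ) ^ (j + 1))).card : ℤ)
      = (Fintype.card K : ℤ) ^ (2 * j) + ε * (Fintype.card K : ℤ) ^ j := by
  have h2 : (2 : F) ≠ 0 := Ring.two_ne_zero hF2
  set q := Fintype.card K with hqdef
  have hq : 1 < q := Fintype.one_lt_card
  have hqC : (q : ℂ) ≠ 0 := by exact_mod_cast (by omega : q ≠ 0)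
  have hcardF : Fintype.card F = q ^ (2 * j + 1) := by
    rw [← hj]; exact Module.card_eq_pow_finrank
  have hcardIm : (imS σ).card = q ^ (2 * j) := by
    have := card_imS σ hfix
    rw [hcardF, pow_succ] at this
    exact Nat.eq_of_mul_eq_mul_right (by omega) this
  obtain ⟨c, hcK⟩ := FiniteField.exists_nonsquare hK2
  have hc0 : c ≠ 0 := by rintro rfl; exact hcK ⟨0, by simp⟩
  have hcF0 : algebraMap K F c ≠ 0 := by simpa using hc0
  have hcF : ¬ IsSquare (algebraMap K F c) := by
    rintro ⟨y, hy⟩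
    apply hcK
    have h := congrArg (Algebra.norm K) hy
    rw [Algebra.norm_algebraMap, hj, map_mul] at h
    refine ⟨Algebra.norm K y / c ^ j, ?_⟩
    field_simp
    linear_combination h
  have hχc : quadraticChar K c = -1 := quadraticChar_neg_one_iff_not_isSquare.mpr hcK
  obtain ⟨g, ⟨s, hs, hg2⟩, hg⟩ := gauss_one_dim hK2 ψ hψ
  set S : F → ℂ := fun u => ∑ x : F, ψ (Algebra.trace K F (u * x * σ x + x * x)) with hS
  set S' : F → ℂ := fun u => ∑ x : F, ψ (c * Algebra.trace K F (u * x * σ x + x * x)) with hS'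
  set A := (Finset.univ : Finset F).filter (fun u => (radS σ u).card = q) with hA
  have hAcard : A.card = q ^ (2 * j) := by
    rw [hA, count_rad σ hF2 hN hσ hfix c hcF, hcardIm]
  have hpowinj : ∀ a b : ℕ, q ^ a = q ^ b → a = b := fun a b h => Nat.pow_right_injective hq h
  have hradcases : ∀ u, (radS σ u).card = q ^ 0 ∨ (radS σ u).card = q ^ 1 ∨
      (radS σ u).card = q ^ 2 := by
    intro u
    by_cases h : ∃ x ∈ radS σ u, x ≠ 0
    · obtain ⟨x, hx, hx0⟩ := h
      have := card_radS σ h2 hN hσ hfix u x hx0 hx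
      split_ifs at this with h
      · exact Or.inr (Or.inr this)
      · exact Or.inr (Or.inl (by rw [this, pow_one]))
    · push Not at h
      left
      have : radS σ u = {0} := by
        ext x
        rw [Finset.mem_singleton]
        exact ⟨h x, by rintro rfl; simp [radS]⟩
      rw [this]; simp
  have hAd : ∀ u d, (radS σ u).card = q ^ d → (u ∈ A ↔ d = 1) := by
    intro u d hd
    simp only [hA, Finset.mem_filter, Finset.mem_univ, true_and, hd]
    constructor
    · intro h; exact hpowinj _ _ (by rw [h, pow_one])
    · rintro rfl; rw [pow_one]
  -- structure of S
  have hstr : ∀ u, ∃ d : ℕ, ∃ δ : ℤ, d ≤ 2 * j + 1 ∧ (δ = 1 ∨ δ = -1) ∧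
      (radS σ u).card = q ^ d ∧ S u = δ * (q : ℂ) ^ d * g ^ (2 * j + 1 - d) ∧
      S' u = (-1) ^ (2 * j + 1 - d) * S u := by
    intro u
    obtain ⟨d, δ, hd, hδ, hrad, hsum⟩ := quad_sum hK2 ψ g hg (formS σ u)
    rw [formS_rad] at hrad
    rw [hj] at hd hsum
    have e1 : S u = δ * (q : ℂ) ^ d * g ^ (2 * j + 1 - d) := by
      have := hsum 1 one_ne_zero
      simp only [one_mul, formS_apply, map_one, Int.cast_one, one_pow] at this
      exact this
    refine ⟨d, δ, hd, hδ, hrad, e1, ?_⟩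
    have := hsum c hc0
    rw [hχc] at this
    simp only [formS_apply] at this
    rw [e1, ← mul_assoc, ← mul_assoc]
    push_cast at this
    exact this
  have hgA : ∃ t : ℤ, (t = 1 ∨ t = -1) ∧ g ^ (2 * j) = t * (q : ℂ) ^ j := by
    refine ⟨s ^ j, ?_, ?_⟩
    · rcases hs with rfl | rfl
      · simp
      · exact neg_one_pow_eq_or ℤ j
    · rw [pow_mul, hg2, mul_pow]; push_cast; rfl
  obtain ⟨t, ht, hgt⟩ := hgA
  have hSA : ∀ u ∈ A, S u = (q : ℂ) ^ (j + 1) ∨ S u = -(q : ℂ) ^ (j + 1) := by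
    intro u hu
    obtain ⟨d, δ, hd, hδ, hrad, e1, -⟩ := hstr u
    have hd1 := (hAd u d hrad).mp hu
    subst hd1
    rw [Nat.add_sub_cancel, hgt] at e1
    rw [e1]
    rcases hδ with rfl | rfl <;> rcases ht with rfl | rfl <;> push_cast
    · left; ring
    · right; ring
    · right; ring
    · left; ring
  have hS'A : ∀ u ∈ A, S' u = S u := by
    intro u hu
    obtain ⟨d, δ, hd, hδ, hrad, -, e2⟩ := hstr u
    have hd1 := (hAd u d hrad).mp hu
    subst hd1
    rw [e2, Nat.add_sub_cancel, pow_mul]; simp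
  have hS'nA : ∀ u, u ∉ A → S' u = - S u := by
    intro u hu
    obtain ⟨d, δ, hd, hδ, hrad, -, e2⟩ := hstr u
    have hd1 : d ≠ 1 := fun h => hu ((hAd u d hrad).mpr h)
    have hodd : Odd (2 * j + 1 - d) := by
      rcases hradcases u with h | h | h <;> rw [h] at hrad <;> have := hpowinj _ _ hrad <;> subst this
      · exact ⟨j, by omega⟩
      · exact absurd rfl hd1
      · exact ⟨j - 1, by omega⟩
    rw [e2, hodd.neg_one_pow]; ring
  have hnormg : ‖g‖ ^ 2 = q := by
    have := congrArg norm hg2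
    rw [norm_pow, norm_mul] at this
    rw [this]
    rcases hs with rfl | rfl <;> simp [hqdef]
  have hmemA : ∀ u (ε : ℤ), (ε = 1 ∨ ε = -1) → S u = ε * (q : ℂ) ^ (j + 1) → u ∈ A := by
    intro u ε hε hSu
    obtain ⟨d, δ, hd, hδ, hrad, e1, -⟩ := hstr u
    rw [hAd u d hrad]
    rw [hSu] at e1
    have := congrArg (fun z => ‖z‖ ^ 2) e1
    have hεn : ‖(ε : ℂ)‖ = 1 := by rcases hε with rfl | rfl <;> simp
    have hδn : ‖(δ : ℂ)‖ = 1 := by rcases hδ with rfl | rfl <;> simp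
    simp only [norm_mul, norm_pow, hεn, hδn, one_mul, Complex.norm_natCast, mul_pow] at this
    rw [← pow_mul ‖g‖, mul_comm _ 2, pow_mul ‖g‖, hnormg, ← pow_mul, ← pow_mul, ← pow_add] at this
    have h' : q ^ ((j + 1) * 2) = q ^ (d * 2 + (2 * j + 1 - d)) := by exact_mod_cast this
    have := hpowinj _ _ h'
    omega
  have h0A : (0 : F) ∉ A := by
    intro h
    have : radS σ (0 : F) = {0} := by
      ext x; simp [radS, h2]
    have h1 := (Finset.mem_filter.mp h).2
    rw [this, Finset.card_singleton] at h1
    omega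
  have hsumS : ∑ u, S u = (q : ℂ) ^ (2 * j + 1) := by
    have := sum_u σ ψ hψ 1
    rw [hcardF] at this
    simp only [map_one, one_mul] at this
    rw [hS, this]; push_cast; rfl
  have hsumS' : ∑ u, S' u = (q : ℂ) ^ (2 * j + 1) := by
    have := sum_u σ ψ hψ c
    rw [hcardF] at this
    push_cast at this
    rw [← this]
    refine Fintype.sum_equiv (Equiv.mulLeft₀ (algebraMap K F c) hcF0) _ _ (fun u => ?_)
    refine Finset.sum_congr rfl fun x _ => ?_
    congr 1
    rw [← smul_eq_mul, ← map_smul]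
    congr 1
    simp only [Algebra.smul_def, Equiv.mulLeft₀_apply]
    ring
  have hsumA : ∑ u ∈ A, S u = (q : ℂ) ^ (2 * j + 1) := by
    have h1 := Finset.sum_add_sum_compl A S
    have h3 := Finset.sum_add_sum_compl A S'
    rw [hsumS] at h1
    rw [hsumS', Finset.sum_congr rfl hS'A,
      Finset.sum_congr rfl (fun u hu => hS'nA u (Finset.mem_compl.mp hu)),
      Finset.sum_neg_distrib] at h3
    linear_combination (h1 + h3) / 2
  set P := A.filter (fun u => S u = (q : ℂ) ^ (j + 1)) with hP
  set M := A.filter (fun u => ¬ S u = (q : ℂ) ^ (j + 1)) with hM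
  have hPM : P.card + M.card = q ^ (2 * j) := by
    rw [← hAcard, hP, hM, Finset.card_filter_add_card_filter_not]
  have hdiff : (P.card : ℤ) - M.card = (q : ℤ) ^ j := by
    rw [← Finset.sum_filter_add_sum_filter_not A (fun u => S u = (q : ℂ) ^ (j + 1)),
      Finset.sum_congr rfl (g := fun _ => (q : ℂ) ^ (j + 1)) (fun u hu => (Finset.mem_filter.mp hu).2),
      Finset.sum_congr (s₁ := M) rfl (g := fun _ => -(q : ℂ) ^ (j + 1)) (fun u hu =>
        (hSA u (Finset.mem_filter.mp hu).1).resolve_left (Finset.mem_filter.mp hu).2),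
      Finset.sum_const, Finset.sum_const, nsmul_eq_mul, nsmul_eq_mul] at hsumA
    have : ((P.card : ℂ) - M.card) * (q : ℂ) ^ (j + 1) = (q : ℂ) ^ j * (q : ℂ) ^ (j + 1) := by
      rw [← pow_add]
      have e : j + (j + 1) = 2 * j + 1 := by ring
      rw [e, ← hsumA]; ring
    have := mul_right_cancel₀ (pow_ne_zero _ hqC) this
    exact_mod_cast this
  have hneg : -(q : ℂ) ^ (j + 1) ≠ (q : ℂ) ^ (j + 1) := by
    intro h
    have : (q : ℂ) ^ (j + 1) = 0 := by linear_combination (-1 / 2 : ℂ) * h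
    exact pow_ne_zero _ hqC this
  have hPM' : (P.card : ℤ) + M.card = (q : ℤ) ^ (2 * j) := by exact_mod_cast hPM
  rcases hε with rfl | rfl
  · have : (Finset.univ.filter (fun u : F => u ≠ 0 ∧
        ∑ x : F, ψ (Algebra.trace K F (u * x * σ x + x * x))
        = ((1 : ℤ) : ℂ) * (q : ℂ) ^ (j + 1))) = P := by
      ext u
      simp only [hP, Finset.mem_filter, Finset.mem_univ, true_and]
      constructor
      · rintro ⟨h, h'⟩
        exact ⟨hmemA u 1 (Or.inl rfl) h', h'.trans (by simp)⟩
      · rintro ⟨h, h'⟩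
        exact ⟨fun h0 => h0A (h0 ▸ h), h'.trans (by simp)⟩
    rw [this]
    linarith
  · have : (Finset.univ.filter (fun u : F => u ≠ 0 ∧
        ∑ x : F, ψ (Algebra.trace K F (u * x * σ x + x * x))
        = ((-1 : ℤ) : ℂ) * (q : ℂ) ^ (j + 1))) = M := by
      ext u
      simp only [hM, Finset.mem_filter, Finset.mem_univ, true_and]
      constructor
      · rintro ⟨h, h'⟩
        have h4 : S u = -(q : ℂ) ^ (j + 1) := h'.trans (by simp)
        exact ⟨hmemA u (-1) (Or.inr rfl) h', by rw [h4]; exact hneg⟩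
      · rintro ⟨h, h'⟩
        exact ⟨fun h0 => h0A (h0 ▸ h), ((hSA u h).resolve_left h').trans (by simp)⟩
    rw [this]
    linarith

end Main

theorem count_u_with_Tu1_eq (p m k : ℕ) (hp : p.Prime) (hodd : Odd p) (hk : 0 < k)
    (e : ℕ) (he : e = Nat.gcd k m) (hge : 3 ≤ m / e) (hoddq : Odd (m / e))
    (F : Type*) [Field F] [Fintype F] [Algebra (ZMod p) F]
    (hcard : Fintype.card F = p ^ m) (ε : ℤ) (hε : ε = 1 ∨ ε = -1) :
    2 * ((Finset.univ.filter (fun u : F => u ≠ 0 ∧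
        ∑ x : F, ePow p (Algebra.trace (ZMod p) F (u * x ^ (p ^ k + 1) + x ^ 2))
          = (ε : ℂ) * (p : ℂ) ^ ((m + e) / 2))).card : ℤ)
      = p ^ (m - e) + ε * p ^ ((m - e) / 2) := by
  have : Fact p.Prime := ⟨hp⟩
  have hp2 : p ≠ 2 := by rintro rfl; exact absurd hodd (by decide)
  have hm : 0 < m := by
    rcases Nat.eq_zero_or_pos m with rfl | h
    · simp at hge
    · exact h
  have he0 : 0 < e := he ▸ Nat.gcd_pos_of_pos_left _ hk
  obtain ⟨j, hj⟩ := hoddq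
  have hem : e ∣ m := he ▸ Nat.gcd_dvd_right k m
  have hme : m = e * (2 * j + 1) := by rw [← hj, Nat.mul_div_cancel' hem]
  have : Finite F := inferInstance
  have : FiniteDimensional (ZMod p) F := Module.Finite.of_finite
  have hfin : Module.finrank (ZMod p) F = m := by
    have h := Module.card_eq_pow_finrank (K := ZMod p) (V := F)
    rw [hcard, ZMod.card] at h
    exact (Nat.pow_right_injective hp.two_le h).symm
  set φ := FiniteField.frobeniusAlgEquivOfAlgebraic (ZMod p) F with hφ
  set σ0 : F ≃ₐ[ZMod p] F := φ ^ k with hσ0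
  have hσ0app : ∀ x, σ0 x = x ^ (p ^ k) := by
    intro x
    rw [hσ0, AlgEquiv.coe_pow, hφ, FiniteField.coe_frobeniusAlgEquivOfAlgebraic_iterate, ZMod.card]
  have hord : orderOf σ0 = 2 * j + 1 := by
    rw [hσ0, orderOf_pow' _ hk.ne', hφ, FiniteField.orderOf_frobeniusAlgEquivOfAlgebraic, hfin,
      Nat.gcd_comm, ← he, hj]
  set L := IntermediateField.fixedField (Subgroup.zpowers σ0) with hL
  have hLfix : ∀ x : L, σ0 (x : F) = x := by
    rintro ⟨x, hx⟩
    rw [hL, IntermediateField.mem_fixedField_iff] at hx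
    exact hx σ0 (Subgroup.mem_zpowers σ0)
  have : Fintype L := Fintype.ofFinite L
  have hfinL : Module.finrank L F = 2 * j + 1 := by
    rw [hL, IntermediateField.finrank_fixedField_eq_card, Nat.card_zpowers, hord]
  have hcardL : Fintype.card L = p ^ e := by
    have h := Module.card_eq_pow_finrank (K := L) (V := F)
    rw [hcard, hfinL, hme, pow_mul] at h
    exact (Nat.pow_left_injective (n := 2 * j + 1) (by omega) h).symm
  let σ : F ≃ₐ[L] F := AlgEquiv.ofRingEquiv (f := σ0.toRingEquiv) (fun x => hLfix x)
  have hσapp : ∀ x, σ x = σ0 x := fun x => rfl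
  have hN : ∀ x : F, σ^[2 * j + 1] x = x := by
    intro x
    have h1 : (σ : F → F) = σ0 := rfl
    rw [h1, ← AlgEquiv.coe_pow, ← hord, pow_orderOf_eq_one]; rfl
  have hfix : ∀ x : F, σ x = x → ∃ a : L, algebraMap L F a = x := by
    intro x hx
    refine ⟨⟨x, ?_⟩, rfl⟩
    rw [hL, IntermediateField.mem_fixedField_iff]
    intro f hf
    have : Subgroup.zpowers σ0 ≤ MulAction.stabilizer (F ≃ₐ[ZMod p] F) x := by
      rw [Subgroup.zpowers_le]; exact hx
    exact this hf
  have : CharP F p := charP_of_injective_algebraMap (algebraMap (ZMod p) F).injective p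
  have : CharP L p := charP_of_injective_algebraMap (algebraMap (ZMod p) L).injective p
  have hF2 : ringChar F ≠ 2 := by rw [ringChar.eq F p]; exact hp2
  have hL2 : ringChar L ≠ 2 := by rw [ringChar.eq L p]; exact hp2
  have : NeZero p := ⟨hp.ne_zero⟩
  let ψ : AddChar L ℂ := (ZMod.stdAddChar (N := p)).compAddMonoidHom
    (Algebra.trace (ZMod p) L).toAddMonoidHom
  have hψ : ψ.IsPrimitive := by
    apply AddChar.IsPrimitive.of_ne_one
    intro h
    obtain ⟨b, hb⟩ := Algebra.trace_surjective (ZMod p) L 1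
    have h1 : ZMod.stdAddChar (N := p) (Algebra.trace (ZMod p) L b) = 1 := DFunLike.congr_fun h b
    rw [hb, ← (ZMod.stdAddChar (N := p)).map_zero_eq_one] at h1
    exact one_ne_zero (ZMod.injective_stdAddChar h1)
  have hep : ∀ a : ZMod p, ePow p a = ZMod.stdAddChar (N := p) a := by
    intro a
    rw [ZMod.stdAddChar_apply, ZMod.toCircle_apply]; rfl
  have key := abstract_main σ hF2 hL2 ⟨j, rfl⟩ hN hfix ψ hψ j hfinL ε hε
  have e1 : (m + e) / 2 = e * (j + 1) := by
    rw [hme, show e * (2 * j + 1) + e = 2 * (e * (j + 1)) by ring]; omega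
  have e2 : m - e = e * (2 * j) := by
    rw [hme, mul_add, mul_one, Nat.add_sub_cancel]
  have e3 : (m - e) / 2 = e * j := by
    rw [e2, show e * (2 * j) = 2 * (e * j) by ring]; omega
  rw [e1, e3, e2, pow_mul _ e (j + 1), pow_mul _ e (2 * j), pow_mul _ e j]
  rw [hcardL] at key
  push_cast at key
  rw [← key]
  congr 3
  refine Finset.filter_congr fun u _ => ?_
  have e4 : ∀ x : F, ePow p (Algebra.trace (ZMod p) F (u * x ^ (p ^ k + 1) + x ^ 2)) =
      ψ (Algebra.trace L F (u * x * σ x + x * x)) := by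
    intro x
    rw [hep]
    change _ = ZMod.stdAddChar (N := p) (Algebra.trace (ZMod p) L (Algebra.trace L F _))
    rw [Algebra.trace_trace, hσapp, hσ0app]
    congr 2
    ring
  simp_rw [e4]
end

section
/- Let p = 3, and m, k positive integers with e = gcd(k,m), m/e ≥ 3 odd, and d satisfying d(3^k+1) ≡ 2 (mod 3^m − 1). Let D(0) = {x ∈ F_{3^m}^* : Tr(x^d) = 0} and for b ∈ F_{3^m} define c_b = (Tr(βb))_{β ∈ D(0)}. Then the code C_{D(0)} = {c_b : b ∈ F_{3^m}} is an F_3-linear code of length 3^{m−1} − 1 and dimension m, and every nonzero codeword has Hamming weight in {2·3^{m−2}, 2·(3^{m−2} − 3^{(m+e)/2 − 2}), 2·(3^{m−2} + 3^{(m+e)/2 − 2})}. -/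
open scoped Classical

lemma sum_of_fiber {K : Type*} [Field K] [Fintype K] (f : K → K)
    (hf : ∀ x, ((Finset.univ.filter (fun u => f u = x)).card : ℤ) = quadraticChar K x + 1)
    (h : K → ℂ) : ∑ u, h (f u) = ∑ x, ((quadraticChar K x : ℂ) + 1) * h x := by
  rw [← Finset.sum_fiberwise' Finset.univ f h]
  refine Finset.sum_congr rfl fun x _ => ?_
  rw [Finset.sum_const, nsmul_eq_mul]
  congr 1
  have := congrArg (fun z : ℤ => (z : ℂ)) (hf x)
  push_cast at this
  exact this

lemma addChar_sum_zero {K : Type*} [Field K] [Fintype K] (ψ : AddChar K ℂ) (hψ : ψ.IsPrimitive)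
    (a : K) (ha : a ≠ 0) : ∑ x, ψ (a * x) = 0 := by
  have := AddChar.sum_mulShift a hψ
  simp only [ha, if_false, Nat.cast_zero] at this
  simpa [mul_comm] using this

noncomputable def qG (K : Type*) [Field K] [Fintype K] (ψ : AddChar K ℂ) : ℂ :=
  gaussSum ((quadraticChar K).ringHomComp (Int.castRingHom ℂ)) ψ

lemma qG_sq {K : Type*} [Field K] [Fintype K] (hK : ringChar K ≠ 2)
    (ψ : AddChar K ℂ) (hψ : ψ.IsPrimitive) :
    qG K ψ ^ 2 = (quadraticChar K (-1) : ℂ) * Fintype.card K := by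
  unfold qG
  rw [gaussSum_sq _ ((quadraticChar_isQuadratic K).comp _) hψ]
  · simp [MulChar.ringHomComp_apply]
  · obtain ⟨a, ha⟩ := quadraticChar_exists_neg_one' hK
    refine MulChar.ne_one_iff.mpr ⟨a, ?_⟩
    simp only [MulChar.ringHomComp_apply, ha]
    norm_num

lemma gauss_quad {K : Type*} [Field K] [Fintype K] (hK : ringChar K ≠ 2)
    (ψ : AddChar K ℂ) (hψ : ψ.IsPrimitive) (a : K) (ha : a ≠ 0) :
    ∑ x, ψ (a * x ^ 2) = (quadraticChar K a : ℂ) * qG K ψ := by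
  have h1 := sum_of_fiber (fun u : K => u ^ 2) (fun x => by
    rw [← quadraticChar_card_sqrts hK x]
    congr 2
    ext; simp) (fun x => ψ (a * x))
  rw [h1]
  simp only [add_mul, one_mul, Finset.sum_add_distrib, addChar_sum_zero ψ hψ a ha, add_zero]
  have h2 := gaussSum_mulShift ((quadraticChar K).ringHomComp (Int.castRingHom ℂ)) ψ (Units.mk0 a ha)
  unfold qG
  rw [← h2]
  simp only [MulChar.ringHomComp_apply, Units.val_mk0, gaussSum, AddChar.mulShift_apply]
  rw [← mul_assoc]
  have : ((quadraticChar K a : ℤ) : ℂ) * (Int.castRingHom ℂ (quadraticChar K a)) = 1 := by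
    have := quadraticChar_sq_one ha
    rw [eq_intCast, ← Int.cast_mul, ← sq, this]; simp
  rw [this, one_mul]
  simp

lemma addChar_prod {K ι : Type*} [Field K] [Fintype ι] (ψ : AddChar K ℂ) (f : ι → K) :
    ψ (∑ i, f i) = ∏ i, ψ (f i) := by
  have : ∀ s : Finset ι, ψ (∑ i ∈ s, f i) = ∏ i ∈ s, ψ (f i) := by
    intro s
    induction s using Finset.induction_on with
    | empty => simp
    | insert a s ha ih => rw [Finset.sum_insert ha, Finset.prod_insert ha, AddChar.map_add_eq_mul, ih]
  exact this _

lemma card_prod_ite {K : Type*} [Field K] [Fintype K] (n : ℕ) (w : Fin n → K) (η : K → ℤ)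
    (hη : ∀ a b, η (a * b) = η a * η b) (h1 : ∀ a, a ≠ 0 → η a = 1 ∨ η a = -1) (γ : ℂ) (Q : ℂ) :
    ∃ s : ℤ, (s = 1 ∨ s = -1) ∧ ∀ l : K, l ≠ 0 →
      ∏ i, (if w i = 0 then Q else (η (l * w i) : ℂ) * γ) =
        Q ^ (Finset.univ.filter (fun i => w i = 0)).card *
        (s * ((η l : ℂ) * γ) ^ (Finset.univ.filter (fun i => ¬ w i = 0)).card) := by
  refine ⟨∏ i ∈ Finset.univ.filter (fun i => ¬ w i = 0), η (w i), ?_, ?_⟩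
  · refine Finset.prod_induction _ (fun s => s = 1 ∨ s = -1) ?_ (Or.inl rfl) ?_
    · rintro a b (rfl | rfl) (rfl | rfl) <;> simp
    · intro i hi; exact h1 _ (by simpa using hi)
  · intro l hl
    rw [Finset.prod_ite, Finset.prod_const, ← Finset.prod_const, ← Finset.prod_const]
    push_cast
    rw [← Finset.prod_mul_distrib]
    congr 1
    refine Finset.prod_congr rfl fun i _ => ?_
    rw [hη]; push_cast; ring

theorem quad_sum_s17 {K V : Type*} [Field K] [Fintype K] (hK : ringChar K ≠ 2)
    [AddCommGroup V] [Module K V] [Fintype V]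
    (ψ : AddChar K ℂ) (hψ : ψ.IsPrimitive) (P : QuadraticForm K V) :
    ∃ r : ℕ, Module.finrank K (LinearMap.ker (QuadraticMap.polarBilin P)) + r = Module.finrank K V ∧
    ∃ s : ℤ, (s = 1 ∨ s = -1) ∧ ∀ l : K, l ≠ 0 → ∑ v, ψ (l * P v) =
      (Fintype.card K : ℂ) ^ (Module.finrank K (LinearMap.ker (QuadraticMap.polarBilin P))) *
        (s * ((quadraticChar K l : ℂ) * qG K ψ) ^ r) := by
  have h2 : (2 : K) ≠ 0 := Ring.two_ne_zero hK
  let _ : Invertible (2 : K) := invertibleOfNonzero h2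
  obtain ⟨w, ⟨φ⟩⟩ := QuadraticForm.equivalent_weightedSumSquares P
  have hker : Module.finrank K (LinearMap.ker (QuadraticMap.polarBilin P))
      = (Finset.univ.filter (fun i => w i = 0)).card := by
    have hpol : ∀ v v', QuadraticMap.polar P v v' = ∑ i, 2 * w i * φ v i * φ v' i := by
      intro v v'
      simp only [QuadraticMap.polar, ← φ.map_app, QuadraticMap.weightedSumSquares_apply, map_add,
        ← Finset.sum_sub_distrib]
      refine Finset.sum_congr rfl fun i _ => ?_
      simp only [Pi.add_apply, smul_eq_mul]; ring
    have hmem : ∀ v, v ∈ LinearMap.ker (QuadraticMap.polarBilin P) ↔ ∀ i, w i ≠ 0 → φ v i = 0 := by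
      intro v
      rw [LinearMap.mem_ker]
      constructor
      · intro h i hi
        have := congrArg (fun L => L (φ.symm (Pi.single i 1))) h
        simp only [QuadraticMap.polarBilin_apply_apply, LinearMap.zero_apply, hpol] at this
        have e1 : φ (φ.symm (Pi.single i 1)) = Pi.single i 1 := φ.toLinearEquiv.apply_symm_apply _
        rw [e1, Finset.sum_eq_single i] at this
        · simpa [h2, hi] using this
        · intro j _ hj; simp [hj]
        · simp
      · intro h
        ext v'
        simp only [QuadraticMap.polarBilin_apply_apply, LinearMap.zero_apply, hpol]
        refine Finset.sum_eq_zero fun i _ => ?_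
        by_cases hi : w i = 0
        · simp [hi]
        · simp [h i hi]
    have e : LinearMap.ker (QuadraticMap.polarBilin P) ≃ ({i // w i = 0} → K) :=
      { toFun := fun v i => φ v.1 i.1
        invFun := fun x => ⟨φ.symm (fun i => if h : w i = 0 then x ⟨i, h⟩ else 0), by
          rw [hmem]; intro i hi
          have e1 : ∀ y, φ (φ.symm y) = y := fun y => φ.toLinearEquiv.apply_symm_apply y
          rw [e1]; simp [hi]⟩
        left_inv := by
          intro v
          apply Subtype.ext
          apply φ.toLinearEquiv.injective
          have e1 : ∀ y, φ (φ.symm y) = y := fun y => φ.toLinearEquiv.apply_symm_apply y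
          change φ (φ.symm _) = φ v.1
          rw [e1]
          ext i
          by_cases hi : w i = 0
          · simp [hi]
          · simp [hi, (hmem v.1).1 v.2 i hi]
        right_inv := by
          intro x
          ext i
          have e1 : ∀ y, φ (φ.symm y) = y := fun y => φ.toLinearEquiv.apply_symm_apply y
          simp [e1, i.2] }
    have hc := Fintype.card_congr e
    rw [Module.card_eq_pow_finrank (K := K), Fintype.card_fun, Fintype.card_subtype] at hc
    exact Nat.pow_right_injective (Fintype.one_lt_card) hc
  obtain ⟨s, hs, hsum⟩ := card_prod_ite _ w (fun x => quadraticChar K x) (fun a b => map_mul _ a b)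
    (fun a ha => quadraticChar_dichotomy ha) (qG K ψ) (Fintype.card K)
  refine ⟨(Finset.univ.filter (fun i => ¬ w i = 0)).card, ?_, s, hs, ?_⟩
  · rw [hker, Finset.card_filter_add_card_filter_not]; simp
  · intro l hl
    rw [hker, ← hsum l hl]
    have : ∀ i, (if w i = 0 then (Fintype.card K : ℂ) else (quadraticChar K (l * w i) : ℂ) * qG K ψ)
        = ∑ x, ψ (l * w i * x ^ 2) := by
      intro i
      split_ifs with h
      · simp [h]
      · rw [gauss_quad hK ψ hψ _ (mul_ne_zero hl h)]
    simp only [this]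
    rw [Finset.prod_univ_sum, Fintype.piFinset_univ]
    refine Fintype.sum_equiv φ.toLinearEquiv.toEquiv _ _ fun v => ?_
    rw [← addChar_prod]
    congr 1
    rw [← φ.map_app, QuadraticMap.weightedSumSquares_apply, Finset.mul_sum]
    refine Finset.sum_congr rfl fun i _ => ?_
    simp only [smul_eq_mul]
    change _ = l * w i * (φ v i) ^ 2
    ring

/-- The sum over `λ = ±1, ±g`. -/
theorem quad_sum_four {K V : Type*} [Field K] [Fintype K] (hK : ringChar K ≠ 2)
    [AddCommGroup V] [Module K V] [Fintype V]
    (ψ : AddChar K ℂ) (hψ : ψ.IsPrimitive) (P : QuadraticForm K V) (g : K) (hg : ¬ IsSquare g)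
    (hodd : Odd (Module.finrank K V)) (n : ℕ)
    (hn : Module.finrank K (LinearMap.ker (QuadraticMap.polarBilin P)) = n) (hn2 : n ≤ 2)
    (S : ℂ) (hS : S = ∑ v, ψ (1 * P v) + ∑ v, ψ ((-1) * P v) + ∑ v, ψ (g * P v)
      + ∑ v, ψ ((-g) * P v)) :
    (n ≠ 1 → S = 0) ∧ (n = 1 → ∃ s : ℤ, (s = 1 ∨ s = -1) ∧
      S = 4 * s * (Fintype.card K : ℂ) ^ ((Module.finrank K V + 1) / 2)) := by
  obtain ⟨r, hr, s, hs, h⟩ := quad_sum_s17 hK ψ hψ P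
  have hg0 : g ≠ 0 := by rintro rfl; exact hg (by simp)
  have hηg : quadraticChar K g = -1 := quadraticChar_neg_one_iff_not_isSquare.mpr hg
  rw [hn] at hr h
  have hng : quadraticChar K (-g) = - quadraticChar K (-1) := by
    rw [neg_eq_neg_one_mul, map_mul, hηg]; ring
  rw [h 1 one_ne_zero, h (-1) (by simp), h g hg0, h (-g) (by simpa), hng, hηg] at hS
  have h1 : quadraticChar K (-1) = 1 ∨ quadraticChar K (-1) = -1 :=
    quadraticChar_dichotomy (by simp)
  constructor
  · intro hne
    have hro : Odd r := by
      obtain ⟨t, ht⟩ := hodd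
      rcases Nat.lt_or_ge n 1 with h0 | h0
      · exact ⟨t, by omega⟩
      · exact ⟨t - 1, by omega⟩
    rw [hS]
    simp only [map_one, Int.cast_one, one_mul, Int.cast_neg, neg_mul, hro.neg_pow]
    ring
  · intro h1n
    obtain ⟨t, ht⟩ := hodd
    have hrt : r = 2 * t := by omega
    subst h1n
    have e1 : (Module.finrank K V + 1) / 2 = 1 + t := by omega
    rw [e1]
    refine ⟨s * (quadraticChar K (-1)) ^ t, ?_, ?_⟩
    · rcases hs with rfl | rfl <;> rcases h1 with h | h <;> rw [h] <;>
        rcases neg_one_pow_eq_or ℤ t with h' | h' <;> simp [h']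
    · have hsq : ((quadraticChar K (-1) : ℤ) : ℂ) ^ 2 = 1 := by
        rcases h1 with h | h <;> rw [h] <;> norm_num
      rw [hS, hrt]
      simp only [map_one, mul_pow, pow_mul, qG_sq hK ψ hψ]
      push_cast
      simp only [neg_sq, hsq, one_pow]
      ring

noncomputable def formP {K F : Type*} [Field K] [Field F] [Algebra K F]
    (σ : F ≃ₐ[K] F) (c : F) : QuadraticForm K F :=
  LinearMap.BilinMap.toQuadraticMap (LinearMap.mk₂ K
    (fun u v => Algebra.trace K F (u * v + c * (u * σ v)))
    (fun a b v => by rw [← map_add]; congr 1; ring)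
    (fun a u v => by rw [← map_smul]; congr 1; simp only [Algebra.smul_def]; ring)
    (fun a u v => by rw [← map_add, map_add σ]; congr 1; ring)
    (fun a u v => by rw [← map_smul, map_smul σ]; congr 1; simp only [Algebra.smul_def]; ring))

lemma formP_apply {K F : Type*} [Field K] [Field F] [Algebra K F]
    (σ : F ≃ₐ[K] F) (c u : F) :
    formP σ c u = Algebra.trace K F (u ^ 2 + c * (u * σ u)) := by
  simp [formP, sq]

lemma trace_aut {K F : Type*} [Field K] [Field F] [Algebra K F] (σ : F ≃ₐ[K] F) (x : F) :
    Algebra.trace K F (σ x) = Algebra.trace K F x := Algebra.trace_eq_of_algEquiv σ x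

lemma radical_eq {K F : Type*} [Field K] [Field F] [Algebra K F] [Fintype K] [Fintype F]
    (σ : F ≃ₐ[K] F) (c u : F) (hu : u ∈ LinearMap.ker (QuadraticMap.polarBilin (formP σ c))) :
    σ c * σ (σ u) = - 2 * σ u - c * u := by
  have key : σ (2 * u + c * σ u) + c * u = 0 := by
    have : ∀ v, Algebra.trace K F ((σ (2 * u + c * σ u) + c * u) * v) = 0 := by
      intro v
      have h := congrArg (fun L => L (σ.symm v)) (LinearMap.mem_ker.1 hu)
      simp only [QuadraticMap.polarBilin_apply_apply, LinearMap.zero_apply, QuadraticMap.polar,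
        formP_apply, map_add σ, AlgEquiv.apply_symm_apply] at h
      rw [← map_sub, ← map_sub] at h
      have e : (u + σ.symm v) ^ 2 + c * ((u + σ.symm v) * (σ u + v)) - (u ^ 2 + c * (u * σ u))
        - ((σ.symm v) ^ 2 + c * (σ.symm v * v))
          = (2 * u + c * σ u) * σ.symm v + c * u * v := by ring
      rw [e, map_add, ← trace_aut σ, map_mul σ, AlgEquiv.apply_symm_apply, ← map_add, ← add_mul] at h
      exact h
    by_contra hne
    obtain ⟨y, hy⟩ := Algebra.trace_surjective K F 1
    have := this ((σ (2 * u + c * σ u) + c * u)⁻¹ * y)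
    rw [← mul_assoc, mul_inv_cancel₀ hne, one_mul, hy] at this
    exact one_ne_zero this
  simp only [map_add, map_mul, map_ofNat] at key
  linear_combination key

lemma neg_fixed {K F : Type*} [Field K] [Field F] [Algebra K F] [Fintype K] [Fintype F]
    (hK : ringChar K ≠ 2) (hodd : Odd (Module.finrank K F))
    (σ : F ≃ₐ[K] F) (x : F) (hx : σ x = - x) : x = 0 := by
  have h1 : Algebra.norm K (σ x) = Algebra.norm K x := Algebra.norm_eq_of_algEquiv σ x
  have h2 : Algebra.norm K (-x) = - Algebra.norm K x := by
    have : -x = algebraMap K F (-1) * x := by simp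
    rw [this, map_mul, Algebra.norm_algebraMap, hodd.neg_one_pow]; ring
  rw [hx, h2] at h1
  have h3 : (2 : K) * Algebra.norm K x = 0 := by linear_combination - h1
  have h4 := (mul_eq_zero.1 h3).resolve_left (Ring.two_ne_zero hK)
  exact Algebra.norm_eq_zero_iff.1 h4

lemma one_nondeg {K F : Type*} [Field K] [Field F] [Algebra K F] [Fintype K] [Fintype F]
    (hK : ringChar K ≠ 2) (hodd : Odd (Module.finrank K F))
    (σ : F ≃ₐ[K] F) (c u u' : F) (hc : c ≠ 0)
    (hu : u ∈ LinearMap.ker (QuadraticMap.polarBilin (formP σ c)))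
    (hu' : u' ∈ LinearMap.ker (QuadraticMap.polarBilin (formP σ (-c)))) : u = 0 ∨ u' = 0 := by
  by_contra! hne
  have h1 := radical_eq σ c u hu
  have h2 := radical_eq σ (-c) u' hu'
  rw [map_neg] at h2
  have hW : c * (u * σ u' + u' * σ u) = 0 := by
    apply neg_fixed hK hodd σ
    simp only [map_add, map_mul]
    linear_combination σ u' * h1 - σ u * h2
  have hW := (mul_eq_zero.1 hW).resolve_left hc
  have : u / u' = 0 := by
    apply neg_fixed hK hodd σ
    have : σ u' ≠ 0 := by simpa using hne.2
    rw [map_div₀, ← neg_div, div_eq_div_iff this hne.2]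
    linear_combination hW
  simp [hne] at this

lemma rad_le_two {K F : Type*} [Field K] [Field F] [Algebra K F] [Fintype K] [Fintype F]
    (σ : F ≃ₐ[K] F) (hfix : ∀ x, σ x = x → ∃ a, algebraMap K F a = x) (c : F) (hc : c ≠ 0) :
    Module.finrank K (LinearMap.ker (QuadraticMap.polarBilin (formP σ c))) ≤ 2 := by
  set R := LinearMap.ker (QuadraticMap.polarBilin (formP σ c)) with hR
  by_cases h0 : R = ⊥
  · rw [h0]; simp
  obtain ⟨u, hu, hu0⟩ := Submodule.exists_mem_ne_zero_of_ne_bot h0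
  let T : F →ₗ[K] F := LinearMap.mulLeft K (c * u) ∘ₗ σ.toLinearMap - LinearMap.mulLeft K (c * σ u)
  have hT : ∀ v, T v = c * (u * σ v - v * σ u) := by
    intro v; simp [T]; ring
  have h1 := LinearMap.finrank_range_add_finrank_ker (T.domRestrict R)
  have h2 : Module.finrank K (LinearMap.range (T.domRestrict R)) ≤ 1 := by
    have : LinearMap.range (T.domRestrict R) ≤ Submodule.span K {(1 : F)} := by
      rintro _ ⟨⟨v, hv⟩, rfl⟩
      have : σ (T v) = T v := by
        rw [hT]
        have e1 := radical_eq σ c u hu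
        have e2 := radical_eq σ c v hv
        simp only [map_sub, map_mul]
        linear_combination σ u * e2 - σ v * e1
      obtain ⟨a, ha⟩ := hfix _ this
      rw [Submodule.mem_span_singleton]
      exact ⟨a, by rw [LinearMap.domRestrict_apply, ← ha, Algebra.smul_def, mul_one]⟩
    exact (Submodule.finrank_mono this).trans (finrank_span_singleton (K := K) (one_ne_zero : (1 : F) ≠ 0)).le
  have h3 : Module.finrank K (LinearMap.ker (T.domRestrict R)) ≤ 1 := by
    have : (LinearMap.ker (T.domRestrict R)).map R.subtype ≤ Submodule.span K {u} := by
      rintro _ ⟨⟨v, hv⟩, hv', rfl⟩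
      have hv' : T v = 0 := hv'
      rw [hT] at hv'
      have hv' := (mul_eq_zero.1 hv').resolve_left hc
      have hsu : σ u ≠ 0 := by simpa using hu0
      obtain ⟨a, ha⟩ := hfix (v / u) (by
        rw [map_div₀, div_eq_div_iff hsu hu0]
        linear_combination hv')
      rw [Submodule.mem_span_singleton]
      refine ⟨a, ?_⟩
      rw [Algebra.smul_def, ha]
      simp [hu0]
    have h4 := (Submodule.finrank_mono this).trans (finrank_span_singleton (K := K) hu0).le
    rwa [Submodule.finrank_map_subtype_eq] at h4
  omega

lemma rad_zero {K F : Type*} [Field K] [Field F] [Algebra K F] [Fintype K] [Fintype F]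
    (hK : ringChar K ≠ 2) (σ : F ≃ₐ[K] F) :
    Module.finrank K (LinearMap.ker (QuadraticMap.polarBilin (formP σ (0 : F)))) = 0 := by
  rw [Submodule.finrank_eq_zero, Submodule.eq_bot_iff]
  intro u hu
  have h := radical_eq σ 0 u hu
  have h2 : (2 : F) ≠ 0 := by
    have := Ring.two_ne_zero hK
    intro h
    apply this
    apply (algebraMap K F).injective
    rw [map_ofNat, map_zero]; exact h
  simpa [h2] using h

/-- The four-term sums. -/
noncomputable def E4 {K F : Type*} [Field K] [Field F] [Algebra K F] [Fintype F]
    (ψ : AddChar K ℂ) (σ : F ≃ₐ[K] F) (g : K) (c : F) : ℂ :=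
  ∑ v, ψ (1 * formP σ c v) + ∑ v, ψ ((-1) * formP σ c v) + ∑ v, ψ (g * formP σ c v)
      + ∑ v, ψ ((-g) * formP σ c v)

lemma E4_zero {K F : Type*} [Field K] [Field F] [Algebra K F] [Fintype K] [Fintype F]
    (hK : ringChar K ≠ 2) (hodd : Odd (Module.finrank K F))
    (ψ : AddChar K ℂ) (hψ : ψ.IsPrimitive) (g : K) (hg : ¬ IsSquare g)
    (σ : F ≃ₐ[K] F) : E4 ψ σ g 0 = 0 :=
  (quad_sum_four hK ψ hψ (formP σ 0) g hg hodd 0 (rad_zero hK σ) (by norm_num) _ rfl).1 (by norm_num)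

lemma E4_add {K F : Type*} [Field K] [Field F] [Algebra K F] [Fintype K] [Fintype F]
    (hK : ringChar K ≠ 2) (hodd : Odd (Module.finrank K F))
    (ψ : AddChar K ℂ) (hψ : ψ.IsPrimitive) (g : K) (hg : ¬ IsSquare g)
    (σ : F ≃ₐ[K] F) (hfix : ∀ x, σ x = x → ∃ a, algebraMap K F a = x) (c : F) (hc : c ≠ 0) :
    ∃ s : ℤ, (s = 0 ∨ s = 1 ∨ s = -1) ∧ E4 ψ σ g c + E4 ψ σ g (-c) =
      4 * s * (Fintype.card K : ℂ) ^ ((Module.finrank K F + 1) / 2) := by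
  have hA := quad_sum_four hK ψ hψ (formP σ c) g hg hodd _ rfl
    (rad_le_two σ hfix c hc) _ rfl
  have hB := quad_sum_four hK ψ hψ (formP σ (-c)) g hg hodd _ rfl
    (rad_le_two σ hfix (-c) (by simpa)) _ rfl
  change (_ → E4 ψ σ g c = 0) ∧ (_ → ∃ s : ℤ, _ ∧ E4 ψ σ g c = _) at hA
  change (_ → E4 ψ σ g (-c) = 0) ∧ (_ → ∃ s : ℤ, _ ∧ E4 ψ σ g (-c) = _) at hB
  by_cases h1 : Module.finrank K (LinearMap.ker (QuadraticMap.polarBilin (formP σ c))) = 1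
  · have h2 : Module.finrank K (LinearMap.ker (QuadraticMap.polarBilin (formP σ (-c)))) = 0 := by
      rw [Submodule.finrank_eq_zero, Submodule.eq_bot_iff]
      intro u' hu'
      have hne : LinearMap.ker (QuadraticMap.polarBilin (formP σ c)) ≠ ⊥ := by
        intro h; rw [h] at h1; simp at h1
      obtain ⟨u, hu, hu0⟩ := Submodule.exists_mem_ne_zero_of_ne_bot hne
      exact (one_nondeg hK hodd σ c u u' hc hu hu').resolve_left hu0
    rw [hB.1 (by omega), add_zero]
    obtain ⟨s, hs, h⟩ := hA.2 h1
    exact ⟨s, Or.inr hs, h⟩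
  · rw [hA.1 h1, zero_add]
    by_cases h2 : Module.finrank K (LinearMap.ker (QuadraticMap.polarBilin (formP σ (-c)))) = 1
    · obtain ⟨s, hs, h⟩ := hB.2 h2
      exact ⟨s, Or.inr hs, h⟩
    · exact ⟨0, Or.inl rfl, by rw [hB.1 h2]; simp⟩

lemma fiber_card {F : Type*} [Field F] [Fintype F] (hF : ringChar F ≠ 2) (q d : ℕ) (hq : Odd q)
    (hd : ∀ x : F, (x ^ (q + 1)) ^ d = x ^ 2) (x : F) :
    ((Finset.univ.filter (fun u : F => u ^ (q + 1) = x)).card : ℤ) = quadraticChar F x + 1 := by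
  rw [← quadraticChar_card_sqrts hF x]
  have hev : Even (q + 1) := hq.add_one
  obtain ⟨t, ht⟩ := hev
  by_cases hx : ∃ v, v ^ 2 = x
  · obtain ⟨v, rfl⟩ := hx
    have h2 : (v ^ d) ^ (q + 1) = v ^ 2 := by rw [← hd v, ← pow_mul, ← pow_mul, mul_comm]
    have e1 : (Finset.univ.filter (fun u : F => u ^ (q + 1) = v ^ 2)) = {v ^ d, - v ^ d} := by
      ext u
      simp only [Finset.mem_filter, Finset.mem_univ, true_and, Finset.mem_insert,
        Finset.mem_singleton]
      constructor
      · intro h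
        apply sq_eq_sq_iff_eq_or_eq_neg.1
        rw [← hd u, ← hd (v ^ d), h, h2]
      · rintro (rfl | rfl)
        · exact h2
        · rw [Even.neg_pow ⟨t, ht⟩, h2]
    have e2 : {u : F | u ^ 2 = v ^ 2}.toFinset = {v, - v} := by
      ext u
      simp [sq_eq_sq_iff_eq_or_eq_neg]
    rw [e1, e2]
    by_cases hv : v = 0
    · subst hv
      have : (0 : F) ^ d = 0 := by
        have := pow_eq_zero_iff (M₀ := F) (a := 0 ^ d) (n := q + 1) (by omega)
        apply this.1; rw [h2]; simp
      rw [this]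
    · have n2 : (2 : F) ≠ 0 := Ring.two_ne_zero hF
      have aux : ∀ y : F, y ≠ 0 → y ≠ - y := by
        intro y hy h
        have : 2 * y = 0 := by linear_combination h
        simp [n2, hy] at this
      rw [Finset.card_pair (aux _ (pow_ne_zero _ hv)), Finset.card_pair (aux _ hv)]
  · have e1 : (Finset.univ.filter (fun u : F => u ^ (q + 1) = x)) = ∅ := by
      ext u
      simp only [Finset.mem_filter, Finset.mem_univ, true_and, Finset.notMem_empty, iff_false]
      intro h
      exact hx ⟨u ^ t, by rw [← h, ht, ← pow_mul]; congr 1; ring⟩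
    have e2 : {u : F | u ^ 2 = x}.toFinset = ∅ := by
      ext u
      simp only [Set.mem_toFinset, Set.mem_ofPred_eq, Finset.notMem_empty, iff_false]
      exact fun h => hx ⟨u, h⟩
    rw [e1, e2]

lemma split_sum {F : Type*} [Field F] [Fintype F] (hF : ringChar F ≠ 2) (q d : ℕ) (hq : Odd q)
    (hd : ∀ x : F, (x ^ (q + 1)) ^ d = x ^ 2) (g : F) (hg : ¬ IsSquare g) (f : F → ℂ) :
    2 * ∑ x, f x = ∑ u, f (u ^ (q + 1)) + ∑ u, f (g * u ^ (q + 1)) := by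
  have hg0 : g ≠ 0 := by rintro rfl; exact hg (by simp)
  have hηg : quadraticChar F g = -1 := quadraticChar_neg_one_iff_not_isSquare.mpr hg
  rw [sum_of_fiber _ (fiber_card hF q d hq hd) f,
    sum_of_fiber _ (fiber_card hF q d hq hd) (fun x => f (g * x))]
  have : ∑ x, ((quadraticChar F x : ℂ) + 1) * f x =
      ∑ x, ((quadraticChar F (g * x) : ℂ) + 1) * f (g * x) :=
    (Fintype.sum_equiv (Equiv.mulLeft₀ g hg0) _ _ (fun x => rfl)).symm
  have h3 : ∑ x, f x = ∑ x, f (g * x) :=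
    (Fintype.sum_equiv (Equiv.mulLeft₀ g hg0) _ _ (fun x => rfl)).symm
  rw [this, ← Finset.sum_add_distrib, h3, Finset.mul_sum]
  refine Finset.sum_congr rfl fun x _ => ?_
  rw [map_mul, hηg]
  push_cast
  ring

lemma nonsquare_up {K F : Type*} [Field K] [Field F] [Algebra K F] [Fintype K] [Fintype F]
    (hodd : Odd (Module.finrank K F)) (g : K) (hg : ¬ IsSquare g) :
    ¬ IsSquare (algebraMap K F g) := by
  rintro ⟨v, hv⟩
  have h := congrArg (Algebra.norm K) hv
  rw [Algebra.norm_algebraMap, map_mul] at h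
  obtain ⟨t, ht⟩ := hodd
  have hg0 : g ≠ 0 := by rintro rfl; exact hg (by simp)
  apply hg
  refine ⟨Algebra.norm K v / g ^ t, ?_⟩
  rw [ht] at h
  field_simp
  linear_combination h

set_option linter.unusedSectionVars false
section core
variable {K F : Type*} [Field K] [Field F] [Fintype K] [Fintype F] [Algebra K F]
  [Algebra (ZMod 3) K] [Algebra (ZMod 3) F] [IsScalarTower (ZMod 3) K F]

noncomputable def chF (F : Type*) [Field F] [Algebra (ZMod 3) F] : AddChar F ℂ :=
  (ZMod.stdAddChar (N := 3)).compAddMonoidHom (Algebra.trace (ZMod 3) F).toAddMonoidHom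

lemma chF_apply (x : F) : chF F x = ZMod.stdAddChar (N := 3) (Algebra.trace (ZMod 3) F x) := rfl

lemma chF_prim (F : Type*) [Field F] [Fintype F] [Algebra (ZMod 3) F] : (chF F).IsPrimitive := by
  apply AddChar.IsPrimitive.of_ne_one
  intro h
  obtain ⟨y, hy⟩ := Algebra.trace_surjective (ZMod 3) F 1
  have h1 := DFunLike.congr_fun h y
  rw [chF_apply, hy, AddChar.one_apply] at h1
  have h2 : (1 : ZMod 3) = 0 := by
    apply ZMod.injective_stdAddChar
    rw [h1, AddChar.map_zero_eq_one]
  exact absurd h2 (by decide)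

noncomputable def GG (σ : F ≃ₐ[K] F) (a c : F) : ℂ := ∑ u, chF F (a * u ^ 2 + c * (u * σ u))

noncomputable def SS (F : Type*) [Field F] [Fintype F] [Algebra (ZMod 3) F] (d : ℕ) (y b : F) : ℂ :=
  ∑ x, chF F (y * x ^ d + b * x)

lemma chK_form (σ : F ≃ₐ[K] F) (l : K) (c u : F) :
    chF K (l * formP σ c u) = chF F (algebraMap K F l * u ^ 2 + (algebraMap K F l * c) * (u * σ u)) := by
  rw [chF_apply, chF_apply, formP_apply, ← smul_eq_mul, ← map_smul, Algebra.trace_trace,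
    Algebra.smul_def]
  congr 2; ring

lemma E4_eq (σ : F ≃ₐ[K] F) (g : K) (c : F) :
    E4 (chF K) σ g c = GG σ 1 c + GG σ (-1) (-c) + GG σ (algebraMap K F g) (algebraMap K F g * c)
      + GG σ (-algebraMap K F g) (-(algebraMap K F g * c)) := by
  simp only [E4, GG, chK_form]
  simp

lemma SS_eq (hF : ringChar F ≠ 2) (q d : ℕ) (hq : Odd q)
    (hd : ∀ x : F, (x ^ (q + 1)) ^ d = x ^ 2) (σ : F ≃ₐ[K] F) (hσ : ∀ x, σ x = x ^ q)
    (hodd : Odd (Module.finrank K F)) (g : K) (hg : ¬ IsSquare g) (y b : F) :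
    2 * SS F d y b = GG σ y b + GG σ (y * algebraMap K F g ^ d) (b * algebraMap K F g) := by
  unfold SS GG
  rw [split_sum hF q d hq hd (algebraMap K F g) (nonsquare_up hodd g hg)]
  congr 1
  · refine Finset.sum_congr rfl fun u _ => ?_
    rw [hd, hσ]; congr 2; ring
  · refine Finset.sum_congr rfl fun u _ => ?_
    rw [mul_pow, hd, hσ]; congr 1; ring

lemma SS_four (hF : ringChar F ≠ 2) (q d : ℕ) (hq : Odd q)
    (hd : ∀ x : F, (x ^ (q + 1)) ^ d = x ^ 2) (σ : F ≃ₐ[K] F) (hσ : ∀ x, σ x = x ^ q)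
    (hodd : Odd (Module.finrank K F)) (g : K) (hg : ¬ IsSquare g) (b : F) :
    2 * (SS F d 1 b + SS F d (-1) b + SS F d 1 (-b) + SS F d (-1) (-b)) =
      E4 (chF K) σ g b + E4 (chF K) σ g (-b) := by
  have hgd : algebraMap K F g ^ d = algebraMap K F g ∨ algebraMap K F g ^ d = - algebraMap K F g := by
    apply sq_eq_sq_iff_eq_or_eq_neg.1
    have h1 : algebraMap K F g ^ q = algebraMap K F g := by rw [← hσ, AlgEquiv.commutes]
    have h2 := hd (algebraMap K F g)
    rw [pow_succ, h1] at h2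
    rw [← h2]; ring
  simp only [mul_add, SS_eq hF q d hq hd σ hσ hodd g hg, E4_eq]
  rcases hgd with h | h <;> rw [h] <;>
  simp only [one_mul, neg_mul, neg_neg, mul_neg, mul_comm b] <;> ring

lemma ind (t : ZMod 3) : 1 + ZMod.stdAddChar (N := 3) t + ZMod.stdAddChar (N := 3) (-t)
    = if t = 0 then (3 : ℂ) else 0 := by
  have h := AddChar.sum_mulShift t (ZMod.isPrimitive_stdAddChar 3)
  have e : ∀ f : ZMod 3 → ℂ, ∑ x, f x = f 0 + f 1 + f (-1) := fun f => Fin.sum_univ_three f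
  rw [e] at h
  simp only [zero_mul, one_mul, neg_mul, AddChar.map_zero_eq_one] at h
  rw [h, ZMod.card]
  split_ifs <;> simp

theorem core (hK : ringChar K ≠ 2) (hF : ringChar F ≠ 2) (q d : ℕ) (hq : Odd q)
    (hd : ∀ x : F, (x ^ (q + 1)) ^ d = x ^ 2) (σ : F ≃ₐ[K] F) (hσ : ∀ x, σ x = x ^ q)
    (hfix : ∀ x, σ x = x → ∃ a, algebraMap K F a = x)
    (hodd : Odd (Module.finrank K F)) :
    3 * (Finset.univ.filter (fun x : F => Algebra.trace (ZMod 3) F (x ^ d) = 0)).card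
      = Fintype.card F ∧
    ∀ b : F, b ≠ 0 → ∃ s : ℤ, (s = 0 ∨ s = 1 ∨ s = -1) ∧
      9 * ((Finset.univ.filter (fun x : F => Algebra.trace (ZMod 3) F (x ^ d) = 0 ∧
        Algebra.trace (ZMod 3) F (x * b) = 0)).card : ℤ)
      = Fintype.card F + 2 * s * (Fintype.card K : ℤ) ^ ((Module.finrank K F + 1) / 2) := by
  obtain ⟨g, hg⟩ := FiniteField.exists_nonsquare hK
  have h0 : SS F d 1 0 + SS F d (-1) 0 = 0 := by
    have := SS_four hF q d hq hd σ hσ hodd g hg 0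
    rw [neg_zero, E4_zero hK hodd _ (chF_prim K) g hg σ] at this
    linear_combination this / 4
  have hind : ∀ x : F, 1 + chF F x + chF F (-x) =
      if Algebra.trace (ZMod 3) F x = 0 then (3 : ℂ) else 0 := by
    intro x
    rw [chF_apply, chF_apply, map_neg, ind]
  constructor
  · have : (3 : ℂ) * (Finset.univ.filter (fun x : F => Algebra.trace (ZMod 3) F (x ^ d) = 0)).card
      = Fintype.card F := by
      have h1 : ∑ x : F, (1 + chF F (x ^ d) + chF F (-(x ^ d))) = Fintype.card F := by
        simp only [Finset.sum_add_distrib]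
        simp only [SS, one_mul, neg_mul, zero_mul, add_zero] at h0
        rw [add_assoc, h0]; simp
      rw [← h1]
      simp only [hind]
      rw [← Finset.sum_filter, Finset.sum_const, nsmul_eq_mul, mul_comm]
    exact_mod_cast this
  · intro b hb
    obtain ⟨s, hs, h⟩ := E4_add hK hodd _ (chF_prim K) g hg σ hfix b hb
    refine ⟨s, hs, ?_⟩
    rw [← SS_four hF q d hq hd σ hσ hodd g hg b] at h
    have : (9 : ℂ) * ((Finset.univ.filter (fun x : F => Algebra.trace (ZMod 3) F (x ^ d) = 0 ∧
        Algebra.trace (ZMod 3) F (x * b) = 0)).card : ℂ)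
      = Fintype.card F + 2 * s * (Fintype.card K : ℂ) ^ ((Module.finrank K F + 1) / 2) := by
      have h1 : ∑ x : F, (1 + chF F (x ^ d) + chF F (-(x ^ d))) *
          (1 + chF F (x * b) + chF F (-(x * b))) = Fintype.card F + (SS F d 1 0 + SS F d (-1) 0)
            + ∑ x, chF F (b * x) + ∑ x, chF F ((-b) * x) +
            (SS F d 1 b + SS F d (-1) b + SS F d 1 (-b) + SS F d (-1) (-b)) := by
        have hc : (Fintype.card F : ℂ) = ∑ x : F, (1 : ℂ) := by simp
        rw [hc]
        simp only [SS, ← Finset.sum_add_distrib]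
        refine Finset.sum_congr rfl fun x _ => ?_
        simp only [one_mul, zero_mul, add_zero, neg_mul, AddChar.map_add_eq_mul, mul_comm x b]
        ring
      rw [h0, addChar_sum_zero _ (chF_prim F) b hb, addChar_sum_zero _ (chF_prim F) (-b) (by simpa)] at h1
      have h2 : ∑ x : F, (1 + chF F (x ^ d) + chF F (-(x ^ d))) *
          (1 + chF F (x * b) + chF F (-(x * b))) =
          (9 : ℂ) * ((Finset.univ.filter (fun x : F => Algebra.trace (ZMod 3) F (x ^ d) = 0 ∧
        Algebra.trace (ZMod 3) F (x * b) = 0)).card : ℂ) := by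
        rw [mul_comm, ← nsmul_eq_mul, ← Finset.sum_const, Finset.sum_filter]
        refine Finset.sum_congr rfl fun x _ => ?_
        rw [hind, hind]
        split_ifs <;> simp_all <;> norm_num
      rw [← h2, h1]
      linear_combination h / 2
    exact_mod_cast this
end core

/-- The fixed field of `x ↦ x ^ (3 ^ k)`. -/
noncomputable def fixK (F : Type*) [Field F] [Algebra (ZMod 3) F] [CharP F 3] (k : ℕ) :
    IntermediateField (ZMod 3) F where
  carrier := {x | x ^ (3 ^ k) = x}
  mul_mem' := by
    intro a b ha hb
    change (a * b) ^ 3 ^ k = a * b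
    rw [mul_pow, show a ^ 3 ^ k = a from ha, show b ^ 3 ^ k = b from hb]
  add_mem' := by
    intro a b ha hb
    change (a + b) ^ 3 ^ k = a + b
    rw [add_pow_char_pow, show a ^ 3 ^ k = a from ha, show b ^ 3 ^ k = b from hb]
  algebraMap_mem' := by
    intro r
    change (algebraMap (ZMod 3) F r) ^ 3 ^ k = algebraMap (ZMod 3) F r
    rw [← map_pow, ZMod.pow_card_pow]
  inv_mem' := by
    intro a ha
    change (a⁻¹) ^ 3 ^ k = a⁻¹
    rw [inv_pow, show a ^ 3 ^ k = a from ha]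

lemma mem_fixK (F : Type*) [Field F] [Algebra (ZMod 3) F] [CharP F 3] (k : ℕ) (x : F) :
    x ∈ fixK F k ↔ x ^ (3 ^ k) = x := Iff.rfl

noncomputable def sigK (F : Type*) [Field F] [Fintype F] [Algebra (ZMod 3) F] [CharP F 3] (k : ℕ) :
    F ≃ₐ[fixK F k] F :=
  AlgEquiv.ofBijective
    ({ iterateFrobenius F 3 k with
        commutes' := fun r => by
          change (r : F) ^ 3 ^ k = r
          exact r.2 } : F →ₐ[fixK F k] F)
    (Finite.injective_iff_bijective.1 (RingHom.injective _))

lemma sigK_apply (F : Type*) [Field F] [Fintype F] [Algebra (ZMod 3) F] [CharP F 3] (k : ℕ) (x : F) :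
    sigK F k x = x ^ 3 ^ k := rfl

lemma card_fixK (F : Type*) [Field F] [Fintype F] [Algebra (ZMod 3) F] [CharP F 3] (m k : ℕ)
    (hcard : Fintype.card F = 3 ^ m) :
    Fintype.card (fixK F k) = 3 ^ Nat.gcd k m := by
  have h1 := IsCyclic.card_powMonoidHom_ker (G := Fˣ) (3 ^ k - 1)
  rw [Nat.card_units, Nat.card_eq_fintype_card (α := F), hcard, Nat.pow_sub_one_gcd_pow_sub_one,
    Nat.gcd_comm] at h1
  have hk : 3 ^ k = (3 ^ k - 1) + 1 := (Nat.sub_add_cancel (Nat.one_le_pow _ _ (by norm_num))).symm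
  have hpow : ∀ x : F, x ≠ 0 → (x ^ 3 ^ k = x ↔ x ^ (3 ^ k - 1) = 1) := by
    intro x hx
    conv_lhs => rw [hk, pow_succ]
    constructor
    · intro h; exact mul_right_cancel₀ hx (by rw [h, one_mul])
    · intro h; rw [h, one_mul]
  have e : (fixK F k)ˣ ≃ (powMonoidHom (3 ^ k - 1) : Fˣ →* Fˣ).ker :=
    { toFun := fun x => ⟨Units.map (algebraMap (fixK F k) F).toMonoidHom x, by
        rw [MonoidHom.mem_ker, powMonoidHom_apply]
        apply Units.ext
        push_cast
        exact (hpow (x.1 : F) (by simp)).1 x.1.2⟩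
      invFun := fun y => Units.mk0 ⟨(y.1 : F), by
        rw [mem_fixK]
        apply (hpow _ (by simp)).2
        have := congrArg Units.val (MonoidHom.mem_ker.1 y.2)
        simpa using this⟩ (by
          intro h
          have := congrArg Subtype.val h
          simp at this)
      left_inv := by
        intro x; apply Units.ext; apply Subtype.ext; rfl
      right_inv := by
        intro y; apply Subtype.ext; apply Units.ext; rfl }
  rw [← Nat.card_congr e, Nat.card_units, Nat.card_eq_fintype_card] at h1
  have h2 : 1 ≤ Fintype.card (fixK F k) := Fintype.card_pos
  have h3 : 1 ≤ 3 ^ Nat.gcd k m := (Nat.one_le_pow _ _ (by norm_num))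
  omega

theorem code_CD0_three_weight (m k : ℕ) (hk : 0 < k) (e : ℕ) (he : e = Nat.gcd k m)
    (hge : 3 ≤ m / e) (hoddq : Odd (m / e))
    (d : ℕ) (hd : 0 < d) (hcong : d * (3 ^ k + 1) ≡ 2 [MOD 3 ^ m - 1])
    (F : Type*) [Field F] [Fintype F] [Algebra (ZMod 3) F]
    (hcard : Fintype.card F = 3 ^ m)
    (D : Finset F)
    (hD : D = Finset.univ.filter (fun x : F => x ≠ 0 ∧ Algebra.trace (ZMod 3) F (x ^ d) = 0)) :
    -- length `3^{m-1} - 1`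
    D.card = 3 ^ (m - 1) - 1 ∧
    -- dimension `m`: the evaluation map `b ↦ (Tr(βb))_{β ∈ D}` is injective
    Function.Injective (fun (b : F) (β : D) => Algebra.trace (ZMod 3) F (β.1 * b)) ∧
    -- the weights of the nonzero codewords
    (∀ b : F, b ≠ 0 →
      ((D.filter (fun β => Algebra.trace (ZMod 3) F (β * b) ≠ 0)).card : ℤ)
        ∈ ({2 * 3 ^ (m - 2),
            2 * (3 ^ (m - 2) - 3 ^ ((m + e) / 2 - 2)),
            2 * (3 ^ (m - 2) + 3 ^ ((m + e) / 2 - 2))} : Set ℤ)) := by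
  have hch : CharP F 3 := by rw [← Algebra.charP_iff (ZMod 3) F 3]; exact ZMod.charP 3
  have hemul : e * (m / e) = m := Nat.mul_div_cancel' (he ▸ Nat.gcd_dvd_right k m)
  have he0 : 0 < e := by rw [he]; exact Nat.gcd_pos_of_pos_left _ hk
  set M := m / e with hM
  have hcK := card_fixK F m k hcard
  rw [← he] at hcK
  have hrank : Module.finrank (fixK F k) F = M := by
    have h := Module.card_eq_pow_finrank (K := fixK F k) (V := F)
    rw [hcard, hcK, ← pow_mul] at h
    have h := Nat.pow_right_injective (le_refl 2 |>.trans (by norm_num : 2 ≤ 3)) h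
    rw [← hemul] at h
    exact (Nat.eq_of_mul_eq_mul_left he0 h).symm
  have hF2 : ringChar F ≠ 2 := by rw [ringChar.eq F 3]; norm_num
  have hchK : CharP (fixK F k) 3 := by
    rw [← Algebra.charP_iff (ZMod 3) (fixK F k) 3]; exact ZMod.charP 3
  have hK2 : ringChar (fixK F k) ≠ 2 := by rw [ringChar.eq (fixK F k) 3]; norm_num
  have hdx : ∀ x : F, (x ^ (3 ^ k + 1)) ^ d = x ^ 2 := by
    intro x
    rw [← pow_mul, mul_comm]
    by_cases hx : x = 0
    · subst hx
      rw [zero_pow (by positivity), zero_pow (by norm_num)]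
    · have hu : (Units.mk0 x hx) ^ (d * (3 ^ k + 1)) = (Units.mk0 x hx) ^ 2 := by
        rw [pow_eq_pow_iff_modEq]
        refine hcong.of_dvd ?_
        have := orderOf_dvd_card (x := Units.mk0 x hx)
        rwa [Fintype.card_units, hcard] at this
      have := congrArg Units.val hu
      simpa using this
  obtain ⟨hc1, hc2⟩ := core hK2 hF2 (3 ^ k) d (Odd.pow (by decide)) hdx (sigK F k)
    (sigK_apply F k) (fun x hx => ⟨⟨x, by rw [mem_fixK]; rwa [sigK_apply] at hx⟩, rfl⟩)
    (by rw [hrank]; exact hoddq)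
  rw [hrank, hcK, hcard] at hc2
  rw [hcard] at hc1
  have hmpos : 3 ≤ m := by nlinarith
  have hexp : e * ((M + 1) / 2) = (m + e) / 2 := by
    obtain ⟨t, ht⟩ := hoddq
    have h1 : (M + 1) / 2 = t + 1 := by omega
    have h2 : m + e = 2 * (e * (t + 1)) := by rw [← hemul, ht]; ring
    rw [h1, h2]; simp
  have hlow : 2 ≤ (m + e) / 2 := by omega
  have hhigh : (m + e) / 2 < m := by
    have : 3 * e ≤ m := by nlinarith
    omega
  have hm1 : (3 : ℕ) ^ m = 3 * 3 ^ (m - 1) := by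
    rw [← pow_succ']; congr 1; omega
  have h0d : (0 : F) ^ d = 0 := zero_pow hd.ne'
  have hDcard : D.card + 1 = 3 ^ (m - 1) := by
    have : Finset.univ.filter (fun x : F => Algebra.trace (ZMod 3) F (x ^ d) = 0)
        = insert 0 D := by
      ext x
      by_cases hx : x = 0
      · simp [hx, h0d]
      · simp [hx, hD]
    rw [this, Finset.card_insert_of_notMem (by simp [hD])] at hc1
    omega
  have hweight : ∀ b : F, b ≠ 0 → ∃ s : ℤ, (s = 0 ∨ s = 1 ∨ s = -1) ∧
      ((D.filter (fun β => Algebra.trace (ZMod 3) F (β * b) ≠ 0)).card : ℤ) =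
        2 * (3 ^ (m - 2) - s * 3 ^ ((m + e) / 2 - 2)) := by
    intro b hb
    obtain ⟨s, hs, h⟩ := hc2 b hb
    refine ⟨s, hs, ?_⟩
    have hz : Finset.univ.filter (fun x : F => Algebra.trace (ZMod 3) F (x ^ d) = 0 ∧
        Algebra.trace (ZMod 3) F (x * b) = 0) =
        insert 0 (D.filter (fun β => Algebra.trace (ZMod 3) F (β * b) = 0)) := by
      ext x
      by_cases hx : x = 0
      · simp [hx, h0d]
      · simp [hx, hD]
    rw [hz, Finset.card_insert_of_notMem (by simp [hD])] at h
    have hsplit := Finset.card_filter_add_card_filter_not (s := D)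
      (fun β => Algebra.trace (ZMod 3) F (β * b) = 0)
    have e1 : (3 : ℤ) ^ m = 9 * 3 ^ (m - 2) := by
      rw [show (9 : ℤ) = 3 ^ 2 by norm_num, ← pow_add]; congr 1; omega
    have e2 : (3 : ℤ) ^ (m - 1) = 3 * 3 ^ (m - 2) := by
      rw [← pow_succ']; congr 1; omega
    have e3 : (3 : ℤ) ^ ((m + e) / 2) = 9 * 3 ^ ((m + e) / 2 - 2) := by
      rw [show (9 : ℤ) = 3 ^ 2 by norm_num, ← pow_add]; congr 1; omega
    have hD' : (D.card : ℤ) + 1 = 3 ^ (m - 1) := by exact_mod_cast hDcard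
    push_cast at h
    rw [← pow_mul, hexp, e1, e3] at h
    rw [e2] at hD'
    have hsplit' : ((D.filter (fun β => Algebra.trace (ZMod 3) F (β * b) = 0)).card : ℤ) +
      ((D.filter (fun β => Algebra.trace (ZMod 3) F (β * b) ≠ 0)).card : ℤ) = D.card := by
      exact_mod_cast hsplit
    have h9 : (9 : ℤ) ≠ 0 := by norm_num
    apply mul_left_cancel₀ h9
    linear_combination 9 * hsplit' + 9 * hD' - h
  refine ⟨by omega, ?_, ?_⟩
  · intro b1 b2 h12
    by_contra hne
    obtain ⟨s, hs, h⟩ := hweight (b1 - b2) (sub_ne_zero.2 hne)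
    have hempty : D.filter (fun β => Algebra.trace (ZMod 3) F (β * (b1 - b2)) ≠ 0) = ∅ := by
      ext β
      simp only [Finset.mem_filter, Finset.notMem_empty, iff_false, not_and, not_not]
      intro hβ
      have := congrFun h12 ⟨β, hβ⟩
      simp only at this
      rw [mul_sub, map_sub, this, sub_self]
    rw [hempty] at h
    have hlt : (3 : ℤ) ^ ((m + e) / 2 - 2) < 3 ^ (m - 2) :=
      pow_lt_pow_right₀ (by norm_num) (by omega)
    have hpos : (0 : ℤ) < 3 ^ ((m + e) / 2 - 2) := by positivity
    simp only [Finset.card_empty, Nat.cast_zero] at h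
    rcases hs with rfl | rfl | rfl <;> linarith
  · intro b hb
    obtain ⟨s, hs, h⟩ := hweight b hb
    rw [h]
    rcases hs with rfl | rfl | rfl <;> simp
end

section
/- Let p = 3, m, k positive integers with e = gcd(k,m), m/e ≥ 3 odd, and suppose either e is even, or e is odd and d ≡ 1 (mod 3^e − 1), where d satisfies d(3^k+1) ≡ 2 (mod 3^m − 1). Fix a ∈ F_3^* and let D(a) = {x ∈ F_{3^m}^* : Tr(x^d) = a}. Then the linear code C_{D(a)} = {(Tr(βb))_{β ∈ D(a)} : b ∈ F_{3^m}} has length 3^{m−1}, dimension m, and every nonzero codeword has weight in {2·3^{m−2}, 2·3^{m−2} − 3^{(m+e)/2 − 2}, 2·3^{m−2} + 3^{(m+e)/2 − 2}}. -/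
open scoped Classical

section partOne
variable {K : Type*} [Field K] [Fintype K]

theorem cda_sum_sq (hK : ringChar K ≠ 2) (f : K → ℂ) :
    ∑ y, f (y ^ 2) = ∑ a, ((quadraticChar K a : ℂ) + 1) * f a := by
  rw [← Finset.sum_fiberwise Finset.univ (fun y : K => y ^ 2)]
  refine Finset.sum_congr rfl fun a _ => ?_
  have h := quadraticChar_card_sqrts hK a
  have h2 : ((Finset.univ.filter (fun y : K => y ^ 2 = a)).card : ℂ)
      = (quadraticChar K a : ℂ) + 1 := by
    rw [← Int.cast_one, ← Int.cast_add, ← h]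
    simp [Set.toFinset_ofPred]
  rw [← h2, ← nsmul_eq_mul, ← Finset.sum_const]
  refine Finset.sum_congr rfl fun y hy => ?_
  rw [(Finset.mem_filter.1 hy).2]

theorem cda_sum_nonsq (hK : ringChar K ≠ 2) (g : K) (hg : ¬ IsSquare g) (f : K → ℂ) :
    ∑ y, f (y ^ 2) + ∑ y, f (g * y ^ 2) = 2 * ∑ a, f a := by
  have hg0 : g ≠ 0 := by rintro rfl; exact hg (IsSquare.zero)
  have hchi : quadraticChar K g = -1 := quadraticChar_neg_one_iff_not_isSquare.mpr hg
  rw [cda_sum_sq hK f, cda_sum_sq hK (fun x => f (g * x))]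
  have : ∑ a, ((quadraticChar K a : ℂ) + 1) * f a
      = ∑ a, ((quadraticChar K (g * a) : ℂ) + 1) * f (g * a) :=
    (Fintype.sum_equiv (Equiv.mulLeft₀ g hg0) _ _ (fun x => by simp)).symm
  have h2 : ∑ a, f a = ∑ a, f (g * a) :=
    (Fintype.sum_equiv (Equiv.mulLeft₀ g hg0) _ _ (fun x => by simp)).symm
  rw [this, h2, ← Finset.sum_add_distrib, Finset.mul_sum]
  refine Finset.sum_congr rfl fun a _ => ?_
  rw [map_mul, hchi]
  push_cast
  ring

theorem cda_map_sum {A ι : Type*} [AddCommMonoid A] (ψ : AddChar A ℂ) (t : Finset ι) (f : ι → A) :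
    ψ (∑ i ∈ t, f i) = ∏ i ∈ t, ψ (f i) := by
  induction t using Finset.induction_on with
  | empty => simp
  | insert a t ha ih => rw [Finset.sum_insert ha, Finset.prod_insert ha, AddChar.map_add_eq_mul, ih]

/-- one-dimensional quadratic Gauss sum -/
noncomputable def cdaG (ψ : AddChar K ℂ) (w : K) : ℂ := ∑ y, ψ (w * y ^ 2)

theorem cdaG_nonsq (hK : ringChar K ≠ 2) (ψ : AddChar K ℂ) (hψ : ψ.IsPrimitive)
    (g : K) (hg : ¬ IsSquare g) (w : K) (hw : w ≠ 0) :
    cdaG ψ (g * w) = - cdaG ψ w := by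
  have h := cda_sum_nonsq hK g hg (fun x => ψ (w * x))
  have h0 : ∑ a, ψ (w * a) = 0 := by
    have := AddChar.sum_mulShift w hψ
    rw [if_neg hw] at this
    simpa [mul_comm] using this
  rw [h0, mul_zero] at h
  rw [eq_neg_iff_add_eq_zero, add_comm, ← h]
  unfold cdaG
  congr 1
  refine Finset.sum_congr rfl fun a _ => ?_
  congr 1; ring

theorem cdaG_sq (hK : ringChar K ≠ 2) (ψ : AddChar K ℂ) (hψ : ψ.IsPrimitive)
    (w : K) (hw : w ≠ 0) :
    cdaG ψ w ^ 2 = (quadraticChar K (-1) : ℂ) * Fintype.card K := by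
  have h0 : ∑ a, ψ (w * a) = 0 := by
    have := AddChar.sum_mulShift w hψ
    rw [if_neg hw] at this
    simpa [mul_comm] using this
  have h1 : cdaG ψ w = gaussSum ((quadraticChar K).ringHomComp (Int.castRingHom ℂ)) (ψ.mulShift w) := by
    unfold cdaG
    rw [cda_sum_sq hK (fun x => ψ (w * x))]
    simp only [add_mul, one_mul, Finset.sum_add_distrib, h0, add_zero]
    rfl
  rw [h1, gaussSum_sq]
  · rfl
  · exact (MulChar.ringHomComp_ne_one_iff (RingHom.injective_int _)).mpr (quadraticChar_ne_one hK)
  · exact (quadraticChar_isQuadratic K).comp _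
  · apply AddChar.IsPrimitive.of_ne_one
    exact hψ hw

variable {V : Type*} [AddCommGroup V] [Module K V] [Fintype V]

theorem cda_quad (hK : ringChar K ≠ 2) (ψ : AddChar K ℂ) (hψ : ψ.IsPrimitive)
    (g : K) (hg : ¬ IsSquare g) (Q : QuadraticForm K V) (hodd : Odd (Module.finrank K V))
    (hR : ∀ S : Finset V, (∀ u ∈ S, ∀ y, Q (u + y) = Q y) → S.card ≤ Fintype.card K ^ 2) :
    ∑ x, ψ (Q x) + ∑ x, ψ (g * Q x) = 0 ∨
    ((∃ u : V, u ≠ 0 ∧ ∀ y, Q (u + y) = Q y) ∧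
      ∃ X : ℂ, X ^ 2 = (Fintype.card K : ℂ) ^ (Module.finrank K V + 1) ∧
      ∑ x, ψ (Q x) + ∑ x, ψ (g * Q x) = 2 * X) := by
  have h2 : (2 : K) ≠ 0 := Ring.two_ne_zero hK
  have : Invertible (2 : K) := invertibleOfNonzero h2
  have hex := QuadraticForm.equivalent_weightedSumSquares Q
  generalize Module.finrank K V = M at hex hodd ⊢
  obtain ⟨w, ⟨φ⟩⟩ := hex
  have hg0 : g ≠ 0 := by rintro rfl; exact hg (IsSquare.zero)
  have hA : ∀ c : K, ∑ x, ψ (c * Q x) = ∏ i, cdaG ψ (c * w i) := by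
    intro c
    have e1 : ∑ x, ψ (c * Q x) = ∑ v : Fin M → K, ∏ i, ψ (c * w i * v i ^ 2) := by
      refine Fintype.sum_equiv φ.toEquiv _ _ fun x => ?_
      have : Q x = QuadraticMap.weightedSumSquares K w (φ x) := (φ.map_app x).symm
      rw [this, QuadraticMap.weightedSumSquares_apply, Finset.mul_sum, cda_map_sum]
      refine Finset.prod_congr rfl fun i _ => ?_
      congr 1
      change _ = c * w i * (φ x i) ^ 2
      rw [smul_eq_mul]; ring
    rw [e1]
    unfold cdaG
    rw [Finset.prod_univ_sum, Fintype.piFinset_univ]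
  have hA1 : ∑ x, ψ (Q x) = ∏ i, cdaG ψ (w i) := by simpa using hA 1
  set Zr := Finset.univ.filter (fun i => w i = 0) with hZr
  set s := Zr.card with hs
  set r := (Finset.univ.filter (fun i => ¬ w i = 0)).card with hr
  have hsr : s + r = M := by
    rw [hs, hr, hZr, Finset.card_filter_add_card_filter_not]; simp
  have hP1 : ∀ c : K, ∏ i, cdaG ψ (c * w i) = (Fintype.card K : ℂ) ^ s *
      ∏ i ∈ Finset.univ.filter (fun i => ¬ w i = 0), cdaG ψ (c * w i) := by
    intro c
    rw [← Finset.prod_filter_mul_prod_filter_not Finset.univ (fun i => w i = 0)]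
    congr 1
    rw [hs, ← Finset.prod_const]
    refine Finset.prod_congr rfl fun i hi => ?_
    rw [(Finset.mem_filter.1 hi).2]; simp [cdaG]
  have hPg : ∏ i, cdaG ψ (g * w i) = (-1) ^ r * ∏ i, cdaG ψ (w i) := by
    have := hP1 1
    simp only [one_mul] at this
    rw [hP1 g, this, hr, mul_left_comm]
    congr 1
    rw [← Finset.prod_const, ← Finset.prod_mul_distrib]
    refine Finset.prod_congr rfl fun i hi => ?_
    rw [cdaG_nonsq hK ψ hψ g hg _ (Finset.mem_filter.1 hi).2]; ring
  -- the radical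
  have hrad : ∀ v : Fin M → K, (∀ i, w i ≠ 0 → v i = 0) →
      ∀ y, Q (φ.symm v + y) = Q y := by
    intro v hv y
    rw [← φ.map_app, ← φ.map_app y, map_add, φ.apply_symm_apply]
    simp only [QuadraticMap.weightedSumSquares_apply]
    refine Finset.sum_congr rfl fun i _ => ?_
    by_cases h : w i = 0
    · simp [h]
    · simp [hv i h]
  have hle : Fintype.card K ^ s ≤ Fintype.card K ^ 2 := by
    refine le_trans ?_ (hR (Finset.univ.filter (fun u : V => ∀ y, Q (u + y) = Q y))
      (fun u hu => (Finset.mem_filter.1 hu).2))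
    have hc : Fintype.card K ^ s = Fintype.card (Zr → K) := by simp [hs]
    rw [hc, ← Finset.card_univ]
    refine Finset.card_le_card_of_injOn
      (fun t => φ.symm (fun i => if h : i ∈ Zr then t ⟨i, h⟩ else 0)) ?_ ?_
    · intro t _
      simp only [Finset.coe_filter, Set.mem_ofPred_eq, Finset.mem_univ, true_and]
      apply hrad
      intro i hi
      rw [dif_neg]; simp [hZr, hi]
    · intro t _ t' _ h
      have h' := φ.symm.toEquiv.injective h
      funext ⟨i, hi⟩
      have := congrFun h' i
      simpa [hi] using this
  have hs2 : s ≤ 2 := (Nat.pow_le_pow_iff_right Fintype.one_lt_card).1 hle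
  rcases Nat.even_or_odd r with hre | hro
  · right
    have hs1 : s = 1 := by
      rcases hodd with ⟨j, hj⟩
      rcases hre with ⟨l, hl⟩
      omega
    constructor
    · obtain ⟨i, hi⟩ := Finset.card_pos.1 (by omega : 0 < Zr.card)
      have hwi : w i = 0 := (Finset.mem_filter.1 hi).2
      refine ⟨φ.symm (Pi.single i 1), ?_, hrad _ ?_⟩
      · intro h
        have : φ (φ.symm (Pi.single i 1)) i = φ 0 i := by rw [h]
        rw [φ.apply_symm_apply, map_zero] at this
        simp at this
      · intro j hj
        rw [Pi.single_eq_of_ne]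
        rintro rfl; exact hj hwi
    · refine ⟨∏ i, cdaG ψ (w i), ?_, ?_⟩
      · have := hP1 1
        simp only [one_mul] at this
        rw [this, mul_pow, ← Finset.prod_pow, Finset.prod_congr rfl (fun i hi =>
          cdaG_sq hK ψ hψ (w i) (Finset.mem_filter.1 hi).2), Finset.prod_const, ← hr, mul_pow]
        have h1 : ((quadraticChar K (-1) : ℤ) : ℂ) ^ r = 1 := by
          obtain ⟨l, hl⟩ := hre
          rw [hl, ← two_mul, pow_mul, ← Int.cast_pow, quadraticChar_sq_one (by simp)]
          simp
        rw [h1, one_mul, ← pow_mul, ← pow_add]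
        congr 1
        omega
      · rw [hA1, hA g, hPg, hre.neg_one_pow]; ring
  · left
    rw [hA1, hA g, hPg, hro.neg_one_pow]; ring

end partOne

section partTwo
variable {F : Type*} [Field F] [Fintype F] [Algebra (ZMod 3) F]

set_option linter.unusedSectionVars false

theorem cda_three : (3 : F) = 0 := by
  have h : (algebraMap (ZMod 3) F) 3 = 0 := by
    rw [show (3 : ZMod 3) = 0 from rfl, map_zero]
  rwa [map_ofNat] at h

theorem cda_two_ne : (2 : F) ≠ 0 := by
  intro h
  have h3 := cda_three (F := F)
  have : (1 : F) = 0 := by linear_combination h3 - h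
  exact one_ne_zero this

theorem cda_ringChar : ringChar F ≠ 2 := by
  intro h
  have := CharP.cast_eq_zero F (ringChar F)
  rw [h] at this
  exact cda_two_ne (by exact_mod_cast this)

theorem cda_neg (σ : F ≃ₐ[ZMod 3] F) (M : ℕ) (hM : Odd M) (hσ : σ ^ M = 1) (u : F)
    (hu : σ u = -u) : u = 0 := by
  have h : ∀ j : ℕ, (σ ^ j) u = (-1) ^ j * u := by
    intro j
    induction j with
    | zero => simp
    | succ j ih => rw [pow_succ, AlgEquiv.mul_apply, hu, map_neg, ih]; ring
  have h1 := h M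
  rw [hσ, hM.neg_one_pow] at h1
  have h2 : (2 : F) * u = 0 := by
    have : u = -1 * u := h1
    linear_combination this
  exact (mul_eq_zero.1 h2).resolve_left cda_two_ne

theorem cda_trace_nondeg (z : F) (h : ∀ y, Algebra.trace (ZMod 3) F (y * z) = 0) : z = 0 := by
  by_contra hz
  obtain ⟨x, hx⟩ := Algebra.trace_surjective (ZMod 3) F 1
  have := h (x * z⁻¹)
  rw [mul_assoc, inv_mul_cancel₀ hz, mul_one, hx] at this
  exact one_ne_zero this

variable (K : IntermediateField (ZMod 3) F) (σ : F ≃ₐ[ZMod 3] F) (hfix : ∀ x, x ∈ K ↔ σ x = x)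

/-- the bilinear map behind the quadratic form -/
noncomputable def cdaB (b : F) : F →ₗ[K] F →ₗ[K] K :=
  LinearMap.mk₂ K (fun x y => Algebra.trace K F (x * y + b * x * σ y))
    (by intro x x' y; rw [← map_add]; congr 1; ring)
    (by
      intro c x y; rw [← map_smul]; congr 1
      rw [Algebra.smul_def, Algebra.smul_def]; ring)
    (by intro x y y'; rw [← map_add, map_add σ]; congr 1; ring)
    (by
      intro c x y
      rw [← map_smul]; congr 1
      rw [Algebra.smul_def, Algebra.smul_def, map_mul]
      rw [show σ (algebraMap K F c) = algebraMap K F c from (hfix _).1 c.2]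
      ring)

noncomputable def cdaQ (b : F) : QuadraticForm K F := LinearMap.BilinMap.toQuadraticMap (cdaB K σ hfix b)

theorem cdaQ_apply (b x : F) :
    cdaQ K σ hfix b x = Algebra.trace K F (x * x + b * x * σ x) := rfl

theorem cda_rad (b u : F) (h : ∀ y, cdaQ K σ hfix b (u + y) = cdaQ K σ hfix b y) :
    σ b * σ (σ u) + 2 * σ u + b * u = 0 := by
  have h0 := h 0
  rw [add_zero, map_zero] at h0
  apply cda_trace_nondeg
  intro z
  obtain ⟨y, rfl⟩ := σ.surjective z
  have h1 := h y
  have h2 : Algebra.trace K F (y * (2 * u + b * σ u) + b * u * σ y) = 0 := by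
    rw [cdaQ_apply] at h0 h1
    rw [cdaQ_apply] at h1
    have e : y * (2 * u + b * σ u) + b * u * σ y = ((u + y) * (u + y) + b * (u + y) * σ (u + y))
      - (y * y + b * y * σ y) - (u * u + b * u * σ u) := by rw [map_add]; ring
    rw [e, map_sub, map_sub, h0, h1]; simp
  have h3 := congrArg (Algebra.trace (ZMod 3) K) h2
  rw [Algebra.trace_trace, map_zero, map_add, ← Algebra.trace_eq_of_algEquiv σ (y * _), ← map_add] at h3
  rw [← h3]
  congr 1
  simp only [map_mul, map_add, map_ofNat]; ring

theorem cda_one (M : ℕ) (hM : Odd M) (hσ : σ ^ M = 1) (b u v : F) (hb : b ≠ 0) (hu : u ≠ 0)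
    (hv : v ≠ 0) (h1 : σ b * σ (σ u) + 2 * σ u + b * u = 0)
    (h2 : σ (-b) * σ (σ v) + 2 * σ v + -b * v = 0) : False := by
  have hU : b * (u * σ v + v * σ u) = 0 := by
    apply cda_neg σ M hM hσ
    simp only [map_mul, map_add]
    rw [map_neg] at h2
    linear_combination σ v * h1 - σ u * h2
  have hU2 := (mul_eq_zero.1 hU).resolve_left hb
  have hv' : σ v ≠ 0 := by simpa using hv
  have ht : u / v = 0 := by
    apply cda_neg σ M hM hσ
    rw [map_div₀]
    field_simp
    linear_combination hU2
  exact (div_ne_zero hu hv) ht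

variable [Fintype K]

theorem cda_card_line (S : Finset F) (c x₀ : F) (hc : c ≠ 0) (h : ∀ x ∈ S, (x - x₀) / c ∈ K) :
    S.card ≤ Fintype.card K := by
  rw [← Fintype.card_coe]
  refine Fintype.card_le_of_injective (fun x : S => (⟨(x.1 - x₀) / c, h x.1 x.2⟩ : K)) ?_
  intro x y hxy
  have := congrArg Subtype.val hxy
  simp only at this
  apply Subtype.ext
  field_simp at this
  linear_combination this

theorem cda_card (hfix : ∀ x, x ∈ K ↔ σ x = x) (b : F) (hb : b ≠ 0) (S : Finset F)
    (hS : ∀ u ∈ S, σ b * σ (σ u) + 2 * σ u + b * u = 0) : S.card ≤ Fintype.card K ^ 2 := by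
  by_cases hz : ∃ u ∈ S, u ≠ 0
  · obtain ⟨u, huS, hu⟩ := hz
    have hα : σ b * σ (σ u) ≠ 0 := by simp [hb, hu]
    have hσu : σ u ≠ 0 := by simpa using hu
    have hσσu : σ (σ u) ≠ 0 := by simpa using hu
    have hu1 := hS u huS
    have key : ∀ v ∈ S, σ b * σ (σ u) * (σ (σ (v / u) - v / u) + (σ (v / u) - v / u))
        + 2 * σ u * (σ (v / u) - v / u) = 0 := by
      intro v hv
      have hv1 := hS v hv
      obtain ⟨t, rfl⟩ : ∃ t, v = u * t := ⟨v / u, by field_simp⟩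
      rw [mul_div_cancel_left₀ _ hu]
      simp only [map_mul, map_sub] at hv1 ⊢
      linear_combination hv1 - t * hu1
    have hcard := Finset.card_le_mul_card_image (f := fun v => σ (v / u) - v / u) S
      (Fintype.card K) (by
        intro τ hτ
        obtain ⟨x₀, hx₀, rfl⟩ := Finset.mem_image.1 hτ
        refine cda_card_line K _ u x₀ hu ?_
        intro x hx
        have hx' := (Finset.mem_filter.1 hx).2
        rw [hfix, sub_div, map_sub]
        linear_combination hx')
    refine hcard.trans ?_
    rw [sq]
    refine Nat.mul_le_mul_left _ ?_
    by_cases hτ : ∃ τ ∈ S.image (fun v => σ (v / u) - v / u), τ ≠ 0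
    · obtain ⟨τ, hτS, hτ0⟩ := hτ
      refine cda_card_line K _ τ 0 hτ0 ?_
      intro x hx
      obtain ⟨v₀, hv₀, h0⟩ := Finset.mem_image.1 hτS
      obtain ⟨v, hv, h1⟩ := Finset.mem_image.1 hx
      have k0 := key v₀ hv₀
      have k1 := key v hv
      rw [h0] at k0
      rw [h1] at k1
      rw [hfix, sub_zero, map_div₀]
      have hστ : σ τ ≠ 0 := by simpa using hτ0
      rw [div_eq_div_iff hστ hτ0]
      apply mul_left_cancel₀ hα
      linear_combination τ * k1 - x * k0
    · push Not at hτ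
      refine cda_card_line K _ 1 0 one_ne_zero ?_
      intro x hx
      rw [hτ x hx]; simp
  · push Not at hz
    have h1 : S ⊆ {0} := fun x hx => by simp [hz x hx]
    have h2 := Finset.card_le_card h1
    have h3 : 1 ≤ Fintype.card K ^ 2 := Nat.one_le_pow _ _ Fintype.card_pos
    simpa using h2.trans h3

/-- the trace character -/
noncomputable def cdaPsi (L : Type*) [Field L] [Algebra (ZMod 3) L] : AddChar L ℂ :=
  (ZMod.stdAddChar (N := 3)).compAddMonoidHom (Algebra.trace (ZMod 3) L).toAddMonoidHom

theorem cdaPsi_apply (L : Type*) [Field L] [Algebra (ZMod 3) L] (x : L) :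
    cdaPsi L x = ZMod.stdAddChar (Algebra.trace (ZMod 3) L x) := rfl

theorem cdaPsi_prim (L : Type*) [Field L] [Finite L] [Algebra (ZMod 3) L] :
    (cdaPsi L).IsPrimitive := by
  apply AddChar.IsPrimitive.of_ne_one
  intro h
  obtain ⟨x, hx⟩ := Algebra.trace_surjective (ZMod 3) L 1
  have h1 : cdaPsi L x = 1 := by rw [h]; rfl
  rw [cdaPsi_apply, hx, (ZMod.isPrimitive_stdAddChar 3).zmod_char_eq_one_iff] at h1
  exact one_ne_zero h1

/-- twice the averaged exponential sum -/
noncomputable def cdaT (g b : F) : ℂ :=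
  ∑ x, cdaPsi F (x * x + b * x * σ x) + ∑ x, cdaPsi F (g * (x * x + b * x * σ x))

theorem cdaT_one (hfix : ∀ x, x ∈ K ↔ σ x = x) (hM : Odd (Module.finrank K F)) (g : K) (hg : ¬ IsSquare g)
    (b : F) (hb : b ≠ 0) :
    cdaT σ (g : F) b = 0 ∨ ((∃ u : F, u ≠ 0 ∧ σ b * σ (σ u) + 2 * σ u + b * u = 0) ∧
      ∃ X : ℂ, X ^ 2 = (Fintype.card K : ℂ) ^ (Module.finrank K F + 1) ∧
        cdaT σ (g : F) b = 2 * X) := by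
  have hKc : ringChar K ≠ 2 := cda_ringChar
  have h := cda_quad hKc (cdaPsi K) (cdaPsi_prim K) g hg (cdaQ K σ hfix b) hM (by
    intro S hS
    apply cda_card K σ hfix b hb
    intro u hu
    exact cda_rad K σ hfix b u (hS u hu))
  have e : ∑ x, cdaPsi K (cdaQ K σ hfix b x) + ∑ x, cdaPsi K (g * cdaQ K σ hfix b x)
      = cdaT σ (g : F) b := by
    unfold cdaT
    congr 1
    · refine Finset.sum_congr rfl fun x _ => ?_
      rw [cdaPsi_apply, cdaPsi_apply, cdaQ_apply, Algebra.trace_trace]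
    · refine Finset.sum_congr rfl fun x _ => ?_
      rw [cdaPsi_apply, cdaPsi_apply, cdaQ_apply, ← smul_eq_mul, ← map_smul, Algebra.trace_trace]
      rfl
  rw [e] at h
  refine h.imp id ?_
  rintro ⟨⟨u, hu, h1⟩, h2⟩
  exact ⟨⟨u, hu, cda_rad K σ hfix b u h1⟩, h2⟩

theorem cdaT_two (hfix : ∀ x, x ∈ K ↔ σ x = x) (hM : Odd (Module.finrank K F)) (hσ : σ ^ (Module.finrank K F) = 1)
    (g : K) (hg : ¬ IsSquare g) (b : F) (hb : b ≠ 0) :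
    ∃ X : ℂ, cdaT σ (g : F) b + cdaT σ (g : F) (-b) = 2 * X ∧
      (X = 0 ∨ X ^ 2 = (Fintype.card K : ℂ) ^ (Module.finrank K F + 1)) := by
  rcases cdaT_one K σ hfix hM g hg b hb with h | ⟨⟨u, hu, h1⟩, X, hX, h⟩
  · rcases cdaT_one K σ hfix hM g hg (-b) (neg_ne_zero.2 hb) with h' | ⟨_, X, hX, h'⟩
    · exact ⟨0, by rw [h, h']; ring, Or.inl rfl⟩
    · exact ⟨X, by rw [h, h']; ring, Or.inr hX⟩
  · rcases cdaT_one K σ hfix hM g hg (-b) (neg_ne_zero.2 hb) with h' | ⟨⟨v, hv, h2⟩, _⟩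
    · exact ⟨X, by rw [h, h']; ring, Or.inr hX⟩
    · exact (cda_one σ _ hM hσ b u v hb hu hv h1 h2).elim

end partTwo

section partThree
variable {F : Type*} [Field F] [Fintype F] [Algebra (ZMod 3) F]

theorem cda_pow_congr (x : F) (a b : ℕ) (ha : 0 < a) (hb : 0 < b)
    (h : a ≡ b [MOD Fintype.card F - 1]) : x ^ a = x ^ b := by
  by_cases hx : x = 0
  · rw [hx, zero_pow ha.ne', zero_pow hb.ne']
  · exact pow_eq_pow_of_modEq h (FiniteField.pow_card_sub_one_eq_one x hx)

/-- the exponential sum -/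
noncomputable def cdaS (F : Type*) [Field F] [Fintype F] [Algebra (ZMod 3) F] (d : ℕ) (b : F) : ℂ :=
  ∑ x : F, cdaPsi F (x ^ d + b * x)

theorem cdaS_eq (σ : F ≃ₐ[ZMod 3] F) (k : ℕ) (hσk : ∀ x, σ x = x ^ 3 ^ k)
    (d d' : ℕ) (hd' : 0 < d') (h1 : ∀ x : F, x ^ (d * d') = x)
    (h2 : ∀ x : F, x ^ (2 * d') = x ^ (3 ^ k + 1))
    (g : F) (hg : ¬ IsSquare g) (hσg : σ g = g) (b : F) :
    2 * (cdaS F d b + cdaS F d (-b)) = cdaT σ g b + cdaT σ g (-b) := by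
  have hS : ∀ b : F, 2 * cdaS F d b = ∑ y, cdaPsi F (y * y + b * y * σ y) +
      ∑ y, cdaPsi F (g * (y * y) + b * g ^ d' * (y * σ y)) := by
    intro b
    let E : F ≃ F :=
      { toFun := fun x => x ^ d'
        invFun := fun x => x ^ d
        left_inv := fun x => by simp only [← pow_mul, mul_comm d' d, h1]
        right_inv := fun x => by simp only [← pow_mul, h1] }
    have e1 : cdaS F d b = ∑ x, cdaPsi F (x + b * x ^ d') := by
      unfold cdaS
      refine (Fintype.sum_equiv E _ _ fun x => ?_).symm
      change _ = cdaPsi F ((x ^ d') ^ d + b * x ^ d')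
      rw [← pow_mul, mul_comm d' d, h1]
    rw [e1, ← cda_sum_nonsq cda_ringChar g hg]
    congr 1
    · refine Finset.sum_congr rfl fun y _ => ?_
      rw [← pow_mul, h2, hσk]
      congr 1; ring
    · refine Finset.sum_congr rfl fun y _ => ?_
      rw [mul_pow, ← pow_mul, h2, hσk]
      congr 1; ring
  have hgd : g ^ d' = g ∨ g ^ d' = -g := by
    rw [← sq_eq_sq_iff_eq_or_eq_neg, ← pow_mul, mul_comm, h2, pow_succ, ← hσk, hσg, sq]
  rw [mul_add, hS, hS]
  unfold cdaT
  rcases hgd with h | h <;> rw [h]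
  · have e : ∀ b : F, ∑ y, cdaPsi F (g * (y * y) + b * g * (y * σ y)) =
        ∑ y, cdaPsi F (g * (y * y + b * y * σ y)) := fun b =>
      Finset.sum_congr rfl fun y _ => by congr 1; ring
    rw [e, e]
  · have e : ∀ b : F, ∑ y, cdaPsi F (g * (y * y) + b * -g * (y * σ y)) =
        ∑ y, cdaPsi F (g * (y * y + -b * y * σ y)) := fun b =>
      Finset.sum_congr rfl fun y _ => by congr 1; ring
    rw [e, e, neg_neg]; ring

theorem cda_chi (t : ZMod 3) : (ZMod.stdAddChar t : ℂ) + ZMod.stdAddChar (-t) =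
    if t = 0 then 2 else -1 := by
  have h := AddChar.sum_mulShift t (ZMod.isPrimitive_stdAddChar 3)
  have e : ∑ x : ZMod 3, (ZMod.stdAddChar (x * t) : ℂ)
      = 1 + ZMod.stdAddChar t + ZMod.stdAddChar (-t) := by
    have := Fin.sum_univ_three (fun x : ZMod 3 => (ZMod.stdAddChar (x * t) : ℂ))
    refine this.trans ?_
    have h0 : (show ZMod 3 from (0 : Fin 3)) * t = 0 := by clear * -; revert t; decide
    have h1 : (show ZMod 3 from (1 : Fin 3)) * t = t := by clear * -; revert t; decide
    have h2 : (show ZMod 3 from (2 : Fin 3)) * t = -t := by clear * -; revert t; decide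
    have h00 : (ZMod.stdAddChar ((show ZMod 3 from (0 : Fin 3)) * t) : ℂ) = 1 := by
      rw [h0, AddChar.map_zero_eq_one]
    exact congrArg₂ (· + ·) (congrArg₂ (· + ·) h00 (congrArg _ h1)) (congrArg _ h2)
  rw [e] at h
  split_ifs with ht
  · rw [if_pos ht, ZMod.card] at h
    push_cast at h
    linear_combination h
  · rw [if_neg ht] at h
    push_cast at h
    linear_combination h

theorem cda_sum_psi_pow (d d' : ℕ) (h1 : ∀ x : F, x ^ (d * d') = x) :
    ∑ x : F, cdaPsi F (x ^ d) = 0 := by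
  let E : F ≃ F :=
    { toFun := fun x => x ^ d
      invFun := fun x => x ^ d'
      left_inv := fun x => by simp only [← pow_mul, h1]
      right_inv := fun x => by simp only [← pow_mul, mul_comm d' d, h1] }
  rw [Fintype.sum_equiv E (fun x => cdaPsi F (x ^ d)) (fun x => cdaPsi F x) (fun x => rfl)]
  have := AddChar.sum_mulShift (1 : F) (cdaPsi_prim F)
  simpa using this

theorem cda_sum_neg (f : F → ℂ) : ∑ x, f (-x) = ∑ x, f x :=
  Fintype.sum_equiv (Equiv.neg F) _ _ (fun _ => rfl)

theorem cda_ind (t a : ZMod 3) : 3 * (if t = a then (1 : ℂ) else 0) =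
    1 + ZMod.stdAddChar t * ZMod.stdAddChar (-a) + ZMod.stdAddChar (-t) * ZMod.stdAddChar a := by
  have h := cda_chi (t - a)
  rw [← AddChar.map_add_eq_mul, ← AddChar.map_add_eq_mul, add_assoc,
    ← sub_eq_add_neg, show -t + a = -(t - a) by ring, h]
  simp only [sub_eq_zero]
  split_ifs <;> norm_num

theorem cda_length (d d' : ℕ) (h1 : ∀ x : F, x ^ (d * d') = x) (hd : Odd d) (a : ZMod 3) :
    3 * ((Finset.univ.filter (fun x : F => Algebra.trace (ZMod 3) F (x ^ d) = a)).card : ℂ)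
      = Fintype.card F := by
  have h0 := cda_sum_psi_pow d d' h1
  have h0' : ∑ x : F, cdaPsi F (-x ^ d) = 0 := by
    rw [← h0, ← cda_sum_neg]
    exact Finset.sum_congr rfl fun x _ => by rw [hd.neg_pow, neg_neg]
  simp only [cdaPsi_apply, map_neg] at h0 h0'
  rw [Finset.card_filter]
  push_cast
  rw [Finset.mul_sum, Finset.sum_congr rfl fun x _ => cda_ind _ a]
  rw [Finset.sum_add_distrib, Finset.sum_add_distrib, ← Finset.sum_mul, ← Finset.sum_mul, h0, h0']
  simp

theorem cda_weight (d d' : ℕ) (h1 : ∀ x : F, x ^ (d * d') = x) (hd : Odd d) (a : ZMod 3)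
    (ha : a ≠ 0) (b : F) (hb : b ≠ 0) :
    9 * ((Finset.univ.filter (fun x : F => Algebra.trace (ZMod 3) F (x ^ d) = a ∧
        Algebra.trace (ZMod 3) F (x * b) ≠ 0)).card : ℂ)
      = 2 * Fintype.card F + (cdaS F d b + cdaS F d (-b)) := by
  have h0 := cda_sum_psi_pow d d' h1
  have h0' : ∑ x : F, cdaPsi F (-x ^ d) = 0 := by
    rw [← h0, ← cda_sum_neg]
    exact Finset.sum_congr rfl fun x _ => by rw [hd.neg_pow, neg_neg]
  have k0 : ∑ x : F, cdaPsi F (x * b) = 0 := by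
    rw [AddChar.sum_mulShift b (cdaPsi_prim F), if_neg hb]; simp
  have k0' : ∑ x : F, cdaPsi F (-(x * b)) = 0 := by
    rw [← k0, ← cda_sum_neg]
    exact Finset.sum_congr rfl fun x _ => by congr 1; ring
  have s1 : cdaS F d b = ∑ x : F, cdaPsi F (x ^ d) * cdaPsi F (x * b) := by
    refine Finset.sum_congr rfl fun x _ => ?_
    rw [← AddChar.map_add_eq_mul, mul_comm b]
  have s2 : cdaS F d (-b) = ∑ x : F, cdaPsi F (x ^ d) * cdaPsi F (-(x * b)) := by
    refine Finset.sum_congr rfl fun x _ => ?_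
    rw [← AddChar.map_add_eq_mul]; congr 1; ring
  have s3 : cdaS F d b = ∑ x : F, cdaPsi F (-x ^ d) * cdaPsi F (-(x * b)) := by
    rw [s1, ← cda_sum_neg]
    refine Finset.sum_congr rfl fun x _ => ?_
    rw [hd.neg_pow, neg_mul]
  have s4 : cdaS F d (-b) = ∑ x : F, cdaPsi F (-x ^ d) * cdaPsi F (x * b) := by
    rw [s2, ← cda_sum_neg]
    refine Finset.sum_congr rfl fun x _ => ?_
    rw [hd.neg_pow, neg_mul, neg_neg]
  have hind : ∀ x : F, 9 * (if Algebra.trace (ZMod 3) F (x ^ d) = a ∧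
        Algebra.trace (ZMod 3) F (x * b) ≠ 0 then (1 : ℂ) else 0) =
      2 - cdaPsi F (x * b) - cdaPsi F (-(x * b))
      + 2 * ZMod.stdAddChar (-a) * cdaPsi F (x ^ d)
      + 2 * ZMod.stdAddChar a * cdaPsi F (-x ^ d)
      - ZMod.stdAddChar (-a) * (cdaPsi F (x ^ d) * cdaPsi F (x * b))
      - ZMod.stdAddChar (-a) * (cdaPsi F (x ^ d) * cdaPsi F (-(x * b)))
      - ZMod.stdAddChar a * (cdaPsi F (-x ^ d) * cdaPsi F (x * b))
      - ZMod.stdAddChar a * (cdaPsi F (-x ^ d) * cdaPsi F (-(x * b))) := by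
    intro x
    have i1 := cda_ind (Algebra.trace (ZMod 3) F (x ^ d)) a
    have i2 := cda_chi (Algebra.trace (ZMod 3) F (x * b))
    have e : (if Algebra.trace (ZMod 3) F (x ^ d) = a ∧
        Algebra.trace (ZMod 3) F (x * b) ≠ 0 then (1 : ℂ) else 0) =
        (if Algebra.trace (ZMod 3) F (x ^ d) = a then 1 else 0) *
        ((2 - (if Algebra.trace (ZMod 3) F (x * b) = 0 then 2 else -1)) / 3) := by
      by_cases c1 : Algebra.trace (ZMod 3) F (x ^ d) = a <;>
      by_cases c2 : Algebra.trace (ZMod 3) F (x * b) = 0 <;> simp [c1, c2]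
      norm_num
    rw [e, ← i2]
    simp only [cdaPsi_apply, map_neg]
    linear_combination (2 - ((ZMod.stdAddChar (Algebra.trace (ZMod 3) F (x * b)) : ℂ) +
      ZMod.stdAddChar (-Algebra.trace (ZMod 3) F (x * b)))) * i1
  have hc := cda_chi a
  rw [if_neg ha] at hc
  rw [Finset.card_filter]
  push_cast
  rw [Finset.mul_sum, Finset.sum_congr rfl fun x _ => hind x]
  simp only [Finset.sum_add_distrib, Finset.sum_sub_distrib, ← Finset.mul_sum]
  rw [h0, h0', k0, k0', ← s1, ← s2, ← s3, ← s4]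
  simp only [Finset.sum_const, Finset.card_univ, nsmul_eq_mul]
  linear_combination (- (cdaS F d b + cdaS F d (-b))) * hc

/-- the main value-set result -/
theorem cda_main (m k : ℕ) (e : ℕ) (he : e = Nat.gcd k m)
    (hge : 3 ≤ m / e) (hoddq : Odd (m / e))
    (d d' : ℕ) (hd' : 0 < d') (h1 : ∀ x : F, x ^ (d * d') = x)
    (h2 : ∀ x : F, x ^ (2 * d') = x ^ (3 ^ k + 1))
    (hcard : Fintype.card F = 3 ^ m) (b : F) (hb : b ≠ 0) :
    cdaS F d b + cdaS F d (-b) = 0 ∨ cdaS F d b + cdaS F d (-b) = 3 ^ ((m + e) / 2) ∨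
    cdaS F d b + cdaS F d (-b) = - 3 ^ ((m + e) / 2) := by
  have hm : Module.finrank (ZMod 3) F = m := by
    have := Module.card_eq_pow_finrank (K := ZMod 3) (V := F)
    rw [hcard, ZMod.card] at this
    exact (Nat.pow_right_injective (le_refl 2 |>.trans (by norm_num) : 2 ≤ 3) this).symm
  have hem : e * (m / e) = m := Nat.mul_div_cancel' (he ▸ Nat.gcd_dvd_right k m)
  set φ := FiniteField.frobeniusAlgEquivOfAlgebraic (ZMod 3) F with hφ
  set σ : F ≃ₐ[ZMod 3] F := φ ^ k with hσdef
  have hσk : ∀ x, σ x = x ^ 3 ^ k := by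
    intro x
    rw [hσdef, AlgEquiv.coe_pow, hφ, FiniteField.coe_frobeniusAlgEquivOfAlgebraic_iterate, ZMod.card]
  have hord : orderOf σ = m / e := by
    rw [hσdef, orderOf_pow, hφ, FiniteField.orderOf_frobeniusAlgEquivOfAlgebraic, hm, he,
      Nat.gcd_comm]
  let K : IntermediateField (ZMod 3) F := IntermediateField.fixedField (Subgroup.zpowers σ)
  have hfix : ∀ x, x ∈ K ↔ σ x = x := by
    intro x
    rw [IntermediateField.mem_fixedField_iff]
    constructor
    · intro h; exact h σ (Subgroup.mem_zpowers σ)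
    · intro h f hf
      have : Subgroup.zpowers σ ≤ MulAction.stabilizer (F ≃ₐ[ZMod 3] F) x := by
        rw [Subgroup.zpowers_le]; exact h
      exact this hf
  have hKF : Module.finrank K F = m / e := by
    rw [IntermediateField.finrank_fixedField_eq_card, Nat.card_zpowers, hord]
  have : Fintype K := Fintype.ofFinite K
  have hK : Fintype.card K = 3 ^ e := by
    have h3 := Module.finrank_mul_finrank (ZMod 3) K F
    rw [hKF, hm] at h3
    have h4 := Module.card_eq_pow_finrank (K := ZMod 3) (V := K)
    rw [h4, ZMod.card]
    congr 1
    exact Nat.eq_of_mul_eq_mul_right (by omega : 0 < m / e) (h3.trans hem.symm)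
  have hM : Odd (Module.finrank K F) := by rw [hKF]; exact hoddq
  have hσ1 : σ ^ (Module.finrank K F) = 1 := by rw [hKF, ← hord, pow_orderOf_eq_one]
  obtain ⟨g, hg⟩ := FiniteField.exists_nonsquare (F := K) cda_ringChar
  have hσg : σ (g : F) = g := (hfix _).1 g.2
  have hgF : ¬ IsSquare (g : F) := by
    rintro ⟨h, hh⟩
    have h5 : σ h = h := by
      have h6 : σ h * σ h = h * h := by rw [← map_mul, ← hh, hσg]
      rcases mul_self_eq_mul_self_iff.1 h6 with h7 | h7
      · exact h7
      · have := cda_neg σ _ hM hσ1 h h7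
        rw [this, map_zero]
    exact hg ⟨⟨h, (hfix h).2 h5⟩, Subtype.ext hh⟩
  obtain ⟨X, hX, hX2⟩ := cdaT_two K σ hfix hM hσ1 g hg b hb
  rw [← cdaS_eq σ k hσk d d' hd' h1 h2 g hgF hσg b] at hX
  have hSX := mul_left_cancel₀ two_ne_zero hX
  rw [hSX]
  refine hX2.imp id fun h => ?_
  rw [← sq_eq_sq_iff_eq_or_eq_neg, h, hK, hKF]
  push_cast
  rw [← pow_mul, ← pow_mul]
  congr 1
  obtain ⟨j, hj⟩ := hoddq
  have : m + e = e * (j + 1) * 2 := by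
    rw [← hem, hj]; ring
  rw [this, Nat.mul_div_cancel _ (by norm_num), ← this, mul_add, hem, mul_one]

end partThree

theorem cda_dodd (m k : ℕ) (e : ℕ) (he : e = Nat.gcd k m) (hge : 3 ≤ m / e) (d : ℕ)
    (hcong : d * (3 ^ k + 1) ≡ 2 [MOD 3 ^ m - 1])
    (hcase : Even e ∨ (Odd e ∧ d ≡ 1 [MOD 3 ^ e - 1])) : Odd d := by
  have hek : e ∣ k := he ▸ Nat.gcd_dvd_left k m
  have hem : e ∣ m := he ▸ Nat.gcd_dvd_right k m
  have key : ∀ n : ℕ, Even n → 3 ^ n % 4 = 1 := by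
    rintro n ⟨l, rfl⟩
    rw [← two_mul, pow_mul, Nat.pow_mod]; simp
  rcases hcase with h | ⟨_, h⟩
  · have h4 : 4 ∣ 3 ^ m - 1 := by
      have := key m (h.trans_dvd hem)
      omega
    have h5 := hcong.of_dvd h4
    have h6 := key k (h.trans_dvd hek)
    rw [← Nat.not_even_iff_odd]
    rintro ⟨l, rfl⟩
    have h7 : (l + l) * (3 ^ k + 1) % 4 = 2 := h5
    obtain ⟨c, hc⟩ : ∃ c, 3 ^ k = 4 * c + 1 := ⟨3 ^ k / 4, by omega⟩
    rw [hc, show (l + l) * (4 * c + 1 + 1) = 4 * (l * (2 * c + 1)) by ring] at h7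
    omega
  · have h2 : 2 ∣ 3 ^ e - 1 := by
      have : Odd (3 ^ e) := Odd.pow (by decide)
      obtain ⟨j, hj⟩ := this
      omega
    have := h.of_dvd h2
    exact Nat.odd_iff.2 this

theorem code_CDa_three_weight (m k : ℕ) (hk : 0 < k) (e : ℕ) (he : e = Nat.gcd k m)
    (hge : 3 ≤ m / e) (hoddq : Odd (m / e))
    (d : ℕ) (hd : 0 < d) (hcong : d * (3 ^ k + 1) ≡ 2 [MOD 3 ^ m - 1])
    (hcase : Even e ∨ (Odd e ∧ d ≡ 1 [MOD 3 ^ e - 1]))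
    (a : ZMod 3) (ha : a ≠ 0)
    (F : Type*) [Field F] [Fintype F] [Algebra (ZMod 3) F]
    (hcard : Fintype.card F = 3 ^ m)
    (D : Finset F)
    (hD : D = Finset.univ.filter (fun x : F => x ≠ 0 ∧ Algebra.trace (ZMod 3) F (x ^ d) = a)) :
    -- length `3^{m-1}`
    D.card = 3 ^ (m - 1) ∧
    -- dimension `m`: the evaluation map `b ↦ (Tr(βb))_{β ∈ D}` is injective
    Function.Injective (fun (b : F) (β : D) => Algebra.trace (ZMod 3) F (β.1 * b)) ∧
    -- the weights of the nonzero codewords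
    (∀ b : F, b ≠ 0 →
      ((D.filter (fun β => Algebra.trace (ZMod 3) F (β * b) ≠ 0)).card : ℤ)
        ∈ ({2 * 3 ^ (m - 2),
            2 * 3 ^ (m - 2) - 3 ^ ((m + e) / 2 - 2),
            2 * 3 ^ (m - 2) + 3 ^ ((m + e) / 2 - 2)} : Set ℤ)) := by
  have hm3 : 3 ≤ m := hge.trans (Nat.div_le_self m e)
  have hem : e * (m / e) = m := Nat.mul_div_cancel' (he ▸ Nat.gcd_dvd_right k m)
  have hdodd := cda_dodd m k e he hge d hcong hcase
  have he0 : 0 < e := by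
    rcases Nat.eq_zero_or_pos e with h | h
    · rw [h] at hge; simp at hge
    · exact h
  have h27 : 3 ^ 3 ≤ 3 ^ m := Nat.pow_le_pow_right (by norm_num) hm3
  have hcop : Nat.Coprime d (3 ^ m - 1) := by
    have hg2 : Nat.gcd d (3 ^ m - 1) ∣ 2 := by
      have h1 : d * (3 ^ k + 1) ≡ 2 [MOD Nat.gcd d (3 ^ m - 1)] :=
        hcong.of_dvd (Nat.gcd_dvd_right _ _)
      exact (h1.dvd_iff dvd_rfl).1 (Dvd.dvd.mul_right (Nat.gcd_dvd_left _ _) _)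
    rcases (Nat.dvd_prime Nat.prime_two).1 hg2 with h | h
    · exact h
    · have h2 : 2 ∣ d := h ▸ Nat.gcd_dvd_left d (3 ^ m - 1)
      obtain ⟨j, hj⟩ := hdodd
      omega
  obtain ⟨d', hd'⟩ : ∃ d', d * d' ≡ 1 [MOD 3 ^ m - 1] := by
    obtain ⟨d', h⟩ := Nat.exists_mul_mod_eq_one_of_coprime hcop (by omega)
    exact ⟨d', by rw [Nat.ModEq, h.2, Nat.mod_eq_of_lt (by omega)]⟩
  have hd'0 : 0 < d' := by
    rcases Nat.eq_zero_or_pos d' with h | h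
    · rw [h, mul_zero, Nat.ModEq, Nat.zero_mod, Nat.mod_eq_of_lt (by omega)] at hd'
      omega
    · exact h
  have h1 : ∀ x : F, x ^ (d * d') = x := by
    intro x
    have := cda_pow_congr x (d * d') 1 (Nat.mul_pos hd hd'0) one_pos (by rw [hcard]; exact hd')
    rwa [pow_one] at this
  have h2 : ∀ x : F, x ^ (2 * d') = x ^ (3 ^ k + 1) := by
    intro x
    refine cda_pow_congr x _ _ (by omega) (Nat.succ_pos _) ?_
    rw [hcard]
    have e1 : d * (3 ^ k + 1) * d' ≡ 2 * d' [MOD 3 ^ m - 1] := hcong.mul_right d'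
    have e2 : d * d' * (3 ^ k + 1) ≡ 1 * (3 ^ k + 1) [MOD 3 ^ m - 1] := hd'.mul_right _
    rw [one_mul] at e2
    rw [mul_right_comm] at e1
    exact e1.symm.trans e2
  have hD' : D = Finset.univ.filter (fun x : F => Algebra.trace (ZMod 3) F (x ^ d) = a) := by
    rw [hD]
    ext x
    simp only [Finset.mem_filter, Finset.mem_univ, true_and, and_iff_right_iff_imp]
    rintro h rfl
    rw [zero_pow hd.ne', map_zero] at h
    exact ha h.symm
  have hj2 : 2 ≤ (m + e) / 2 := by omega
  have hjm : (m + e) / 2 ≤ m := by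
    have : e ≤ m := Nat.le_of_dvd (by omega) (he ▸ Nat.gcd_dvd_right k m)
    omega
  have hweights : ∀ b : F, b ≠ 0 →
      ((D.filter (fun β => Algebra.trace (ZMod 3) F (β * b) ≠ 0)).card : ℤ)
        ∈ ({2 * 3 ^ (m - 2),
            2 * 3 ^ (m - 2) - 3 ^ ((m + e) / 2 - 2),
            2 * 3 ^ (m - 2) + 3 ^ ((m + e) / 2 - 2)} : Set ℤ) := by
    intro b hb
    have hw := cda_weight d d' h1 hdodd a ha b hb
    rw [hD', Finset.filter_filter]
    generalize (Finset.univ.filter (fun x : F => Algebra.trace (ZMod 3) F (x ^ d) = a ∧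
        Algebra.trace (ZMod 3) F (x * b) ≠ 0)).card = W at hw ⊢
    have p1 : (3 : ℤ) ^ m = 9 * 3 ^ (m - 2) := by
      conv_lhs => rw [show m = 2 + (m - 2) by omega, pow_add]
      norm_num
    have p2 : (3 : ℤ) ^ ((m + e) / 2) = 9 * 3 ^ ((m + e) / 2 - 2) := by
      conv_lhs => rw [show (m + e) / 2 = 2 + ((m + e) / 2 - 2) by omega, pow_add]
      norm_num
    rw [hcard] at hw
    simp only [Set.mem_insert_iff, Set.mem_singleton_iff]
    rcases cda_main m k e he hge hoddq d d' hd'0 h1 h2 hcard b hb with h | h | h <;> rw [h] at hw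
    · left
      have hw' : (9 * W : ℤ) = 2 * 3 ^ m := by
        have : (9 * W : ℂ) = 2 * 3 ^ m := by rw [hw]; push_cast; ring
        exact_mod_cast this
      omega
    · right; right
      have hw' : (9 * W : ℤ) = 2 * 3 ^ m + 3 ^ ((m + e) / 2) := by
        have : (9 * W : ℂ) = 2 * 3 ^ m + 3 ^ ((m + e) / 2) := by rw [hw]; push_cast; ring
        exact_mod_cast this
      omega
    · right; left
      have hw' : (9 * W : ℤ) + 3 ^ ((m + e) / 2) = 2 * 3 ^ m := by
        have : (9 * W : ℂ) + 3 ^ ((m + e) / 2) = 2 * 3 ^ m := by rw [hw]; push_cast; ring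
        exact_mod_cast this
      omega
  refine ⟨?_, ?_, hweights⟩
  · have hl := cda_length d d' h1 hdodd a
    rw [hcard] at hl
    have hl' : 3 * (Finset.univ.filter
        (fun x : F => Algebra.trace (ZMod 3) F (x ^ d) = a)).card = 3 ^ m := by
      exact_mod_cast hl
    rw [← hD'] at hl'
    have : 3 ^ m = 3 * 3 ^ (m - 1) := by
      rw [← pow_succ']; congr 1; omega
    omega
  · intro b c hbc
    by_contra hne
    have h0 := hweights (b - c) (sub_ne_zero.2 hne)
    have hempty : D.filter (fun β => Algebra.trace (ZMod 3) F (β * (b - c)) ≠ 0) = ∅ := by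
      rw [Finset.filter_eq_empty_iff]
      intro β hβ
      have := congrFun hbc ⟨β, hβ⟩
      simp only at this
      rw [not_not, mul_sub, map_sub, this, sub_self]
    rw [hempty, Finset.card_empty] at h0
    have q1 : (3 : ℤ) ^ ((m + e) / 2 - 2) ≤ 3 ^ (m - 2) :=
      pow_le_pow_right₀ (by norm_num) (by omega)
    have q2 : (0 : ℤ) < 3 ^ ((m + e) / 2 - 2) := by positivity
    simp only [Set.mem_insert_iff, Set.mem_singleton_iff] at h0
    push_cast at h0
    omega
end
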